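/- (Gromov's non-squeezing theorem, Theorem 1.7 of the paper.) Let N ≥ 1, R, r > 0, z = (z₁, z₂) ∈ ℝ², 1 ≤ k₀ ≤ N, and x* ∈ ℝ^{2N}. Let φ be a symplectomorphism defined on B_R(x*). If r < R, then the image φ(B_R(x*)) is not contained in the cylinder C_r(z; k₀). -/

import Mathlib

/-- The standard symplectic form on `ℝ^{2N}`, realized as `EuclideanSpace ℝ (Fin N ⊕ Fin N)`,
where the coordinate `w_i` (resp. `w_{N+i}`) corresponds to the index `Sum.inl i`
(resp. `Sum.inr i`): `ω₀(u, v) = ∑_{i=1}^N (u_i v_{N+i} - u_{N+i} v_i)`. -/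
noncomputable def omega0 (N : ℕ) (u v : EuclideanSpace ℝ (Fin N ⊕ Fin N)) : ℝ :=
  ∑ i : Fin N, (u (Sum.inl i) * v (Sum.inr i) - u (Sum.inr i) * v (Sum.inl i))

/-- The cylinder `C_r(z; k₀) = {w ∈ ℝ^{2N} : (w_{k₀} - z₁)² + (w_{N+k₀} - z₂)² ≤ r²}`. -/
def cylinder (N : ℕ) (r : ℝ) (z₁ z₂ : ℝ) (k₀ : Fin N) : Set (EuclideanSpace ℝ (Fin N ⊕ Fin N)) :=
  {w | (w (Sum.inl k₀) - z₁) ^ 2 + (w (Sum.inr k₀) - z₂) ^ 2 ≤ r ^ 2}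

section

open Set Metric MeasureTheory Module Polynomial

/-- A map vanishing on a sphere and Lipschitz on the closed ball extends by zero to a Lipschitz map. -/
theorem LipschitzOnWith.extend_zero_closedBall {E : Type*} [NormedAddCommGroup E] [NormedSpace ℝ E]
    {u : E → E} {K : ℝ} {L : NNReal} (hL : LipschitzOnWith L u (closedBall 0 K))
    (hu : ∀ x, ‖x‖ = K → u x = 0) :
    LipschitzWith L ((closedBall (0 : E) K).indicator u) := by
  have key : ∀ x y, ‖x‖ ≤ K → K < ‖y‖ → ‖u x‖ ≤ L * ‖x - y‖ := by
    intro x y hx hy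
    have hc : ContinuousOn (fun s : ℝ ↦ ‖x + s • (y - x)‖) (Icc 0 1) := by fun_prop
    obtain ⟨s, hs, hsK⟩ := intermediate_value_Icc zero_le_one hc
      (show K ∈ Icc ‖x + (0 : ℝ) • (y - x)‖ ‖x + (1 : ℝ) • (y - x)‖ by simp [hx, hy.le])
    have h1 := hL.norm_sub_le (x := x) (by simpa using hx) (y := x + s • (y - x)) (by simp [hsK])
    rw [hu _ hsK, sub_zero] at h1
    refine h1.trans (mul_le_mul_of_nonneg_left ?_ L.2)
    have : x - (x + s • (y - x)) = s • (x - y) := by module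
    rw [this, norm_smul, Real.norm_of_nonneg hs.1]
    exact mul_le_of_le_one_left (norm_nonneg _) hs.2
  refine LipschitzWith.of_dist_le_mul fun x y ↦ ?_
  rw [dist_eq_norm, dist_eq_norm]
  by_cases hx : x ∈ closedBall (0 : E) K <;> by_cases hy : y ∈ closedBall (0 : E) K
  · rw [indicator_of_mem hx, indicator_of_mem hy]; exact hL.norm_sub_le hx hy
  · rw [indicator_of_mem hx, indicator_of_notMem hy, sub_zero]
    exact key x y (by simpa using hx) (by simpa using hy)
  · rw [indicator_of_notMem hx, indicator_of_mem hy, zero_sub, norm_neg, norm_sub_rev]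
    exact key y x (by simpa using hy) (by simpa using hx)
  · rw [indicator_of_notMem hx, indicator_of_notMem hy]; simp; positivity

theorem LipschitzWith.bijective_id_add {E : Type*} [NormedAddCommGroup E] [CompleteSpace E]
    {v : E → E} {L : NNReal} (hL : LipschitzWith L v) (hL1 : L < 1) :
    Function.Bijective (fun x ↦ x + v x) := by
  constructor
  · intro x y hxy
    have h := hL.norm_sub_le x y
    have h2 : v x - v y = -(x - y) := by
      simp only at hxy
      rw [neg_sub, sub_eq_sub_iff_add_eq_add, add_comm (v x), hxy, add_comm]
    rw [h2, norm_neg] at h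
    by_contra hne
    have h0 : 0 < ‖x - y‖ := norm_pos_iff.2 (sub_ne_zero.2 hne)
    have : (L : ℝ) < 1 := by exact_mod_cast hL1
    nlinarith
  · intro y
    have hc : ContractingWith L (fun x ↦ y - v x) := by
      refine ⟨hL1, LipschitzWith.of_dist_le_mul fun a b ↦ ?_⟩
      rw [dist_sub_left]
      exact hL.dist_le_mul a b
    refine ⟨hc.fixedPoint _, ?_⟩
    have := hc.fixedPoint_isFixedPt
    unfold Function.IsFixedPt at this
    simp only at this ⊢
    nth_rewrite 1 [← this]
    abel

section
variable {E : Type*} [NormedAddCommGroup E] [NormedSpace ℝ E] [FiniteDimensional ℝ E]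

theorem LinearMap.det_one_add_eq_sum (A : E →ₗ[ℝ] E) (s : ℕ → ℝ)
    (hs : Function.Injective s) :
    (1 + A).det = ∑ i ∈ Finset.range (finrank ℝ E + 1),
      (Lagrange.basis (Finset.range (finrank ℝ E + 1)) s i).eval 1 * (s i • 1 + A).det := by
  have hev : ∀ t : ℝ, (-A).charpoly.eval t = (t • 1 + A).det := fun t ↦ by
    rw [LinearMap.eval_charpoly, sub_neg_eq_add, Algebra.algebraMap_eq_smul_one]
  have hdeg : (-A).charpoly.degree < (Finset.range (finrank ℝ E + 1)).card := by
    rw [degree_eq_natDegree (LinearMap.charpoly_monic _).ne_zero, LinearMap.charpoly_natDegree,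
      Finset.card_range]
    exact_mod_cast Nat.lt_succ_self _
  have h := congrArg (eval (1 : ℝ)) (Lagrange.eq_interpolate (v := s) hs.injOn hdeg)
  rw [hev, one_smul, Lagrange.interpolate_apply, eval_finsetSum] at h
  rw [h]
  refine Finset.sum_congr rfl fun i _ ↦ ?_
  rw [eval_mul, eval_C, hev, mul_comm]

variable [MeasurableSpace E] [BorelSpace E] (μ : Measure E) [μ.IsAddHaarMeasure]

theorem setIntegral_det_of_lipschitz {v : E → E} (hv : ContDiff ℝ 1 v) {K : ℝ} {L : NNReal}
    (hL : LipschitzOnWith L v (closedBall 0 K)) (hL1 : L < 1)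
    (hv0 : ∀ x, ‖x‖ = K → v x = 0)
    (hdet : ∀ x ∈ closedBall (0 : E) K, 0 < (ContinuousLinearMap.id ℝ E + fderiv ℝ v x).det) :
    ∫ x in closedBall (0 : E) K, (ContinuousLinearMap.id ℝ E + fderiv ℝ v x).det ∂μ
      = μ.real (closedBall 0 K) := by
  have hbij := (hL.extend_zero_closedBall hv0).bijective_id_add hL1
  set w := (closedBall (0 : E) K).indicator v
  have hw : ∀ x ∈ closedBall (0 : E) K, w x = v x := fun x hx ↦ indicator_of_mem hx _
  have hw0 : ∀ x ∉ closedBall (0 : E) K, w x = 0 := fun x hx ↦ indicator_of_notMem hx _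
  have himg : (fun x ↦ x + v x) '' closedBall 0 K = closedBall 0 K := by
    have h1 : (fun x ↦ x + v x) '' closedBall 0 K = (fun x ↦ x + w x) '' closedBall 0 K :=
      image_congr fun x hx ↦ by rw [hw x hx]
    have h2 : (fun x ↦ x + w x) '' (closedBall 0 K)ᶜ = (closedBall 0 K)ᶜ := by
      conv_rhs => rw [← image_id ((closedBall (0 : E) K)ᶜ)]
      exact image_congr fun x hx ↦ by simp [hw0 x hx]
    rw [h1, ← compl_inj_iff, ← image_compl_eq hbij, h2]
  have hinj : InjOn (fun x ↦ x + v x) (closedBall 0 K) := by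
    intro x hx y hy hxy
    exact hbij.1 (by simpa [hw x hx, hw y hy] using hxy)
  have hd : ∀ x ∈ closedBall (0 : E) K, HasFDerivWithinAt (fun x ↦ x + v x)
      (ContinuousLinearMap.id ℝ E + fderiv ℝ v x) (closedBall 0 K) x := fun x _ ↦
    ((hasFDerivAt_id x).add
      (hv.differentiable one_ne_zero x).hasFDerivAt).hasFDerivWithinAt
  have := integral_image_eq_integral_abs_det_fderiv_smul μ measurableSet_closedBall hd hinj
    (fun _ ↦ (1 : ℝ))
  rw [himg] at this
  simp only [smul_eq_mul, mul_one, integral_const, measureReal_restrict_apply_univ] at this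
  rw [this]
  exact setIntegral_congr_fun measurableSet_closedBall fun x hx ↦ (abs_of_pos (hdet x hx)).symm

theorem setIntegral_det_id_add {u : E → E} (hu : ContDiff ℝ 1 u) {K : ℝ}
    (hu0 : ∀ x, ‖x‖ = K → u x = 0) :
    ∫ x in closedBall (0 : E) K, (ContinuousLinearMap.id ℝ E + fderiv ℝ u x).det ∂μ
      = μ.real (closedBall 0 K) := by
  obtain ⟨L, hL⟩ := hu.contDiffOn.exists_lipschitzOnWith one_ne_zero (convex_closedBall (0 : E) K)
    (isCompact_closedBall 0 K)
  have hDc : Continuous (fderiv ℝ u) := hu.continuous_fderiv one_ne_zero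
  obtain ⟨M, hM⟩ := (isCompact_closedBall (0 : E) K).exists_bound_of_continuousOn hDc.continuousOn
  have hdetc : Continuous (fun A : E →L[ℝ] E ↦ A.det) := ContinuousLinearMap.continuous_det
  obtain ⟨ε, hε, hεdet⟩ : ∃ ε > 0, ∀ A : E →L[ℝ] E, ‖A‖ < ε →
      0 < (ContinuousLinearMap.id ℝ E + A).det := by
    have h := (hdetc.comp (continuous_const.add continuous_id :
      Continuous fun A : E →L[ℝ] E ↦ ContinuousLinearMap.id ℝ E + A)).continuousAt (x := 0)
    have h1 := h.eventually_const_lt (u := 0) (by simp [ContinuousLinearMap.det])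
    obtain ⟨ε, hε, h2⟩ := Metric.eventually_nhds_iff.1 h1
    exact ⟨ε, hε, fun A hA ↦ h2 (by simpa using hA)⟩
  set s₀ : ℝ := L + |M| / ε + 1
  have hs₀ : 0 < s₀ := by positivity
  have large : ∀ s : ℝ, s₀ ≤ s →
      ∫ x in closedBall (0 : E) K, (s • ContinuousLinearMap.id ℝ E + fderiv ℝ u x).det ∂μ
        = s ^ finrank ℝ E * μ.real (closedBall 0 K) := by
    intro s hs
    have hspos : 0 < s := hs₀.trans_le hs
    have hsi : 0 ≤ s⁻¹ := inv_nonneg.2 hspos.le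
    have hfd : ∀ x, fderiv ℝ (fun y ↦ s⁻¹ • u y) x = s⁻¹ • fderiv ℝ u x := fun x ↦
      fderiv_fun_const_smul (hu.differentiable one_ne_zero x) _
    have h1 := setIntegral_det_of_lipschitz μ (v := fun x ↦ s⁻¹ • u x)
      (hu.const_smul _) (K := K) (L := s⁻¹.toNNReal * L) ?_ ?_ ?_ ?_
    · rw [← h1, ← integral_const_mul]
      refine integral_congr_ae (Filter.Eventually.of_forall fun x ↦ ?_)
      simp only [hfd]
      have : s • ContinuousLinearMap.id ℝ E + fderiv ℝ u x
          = s • (ContinuousLinearMap.id ℝ E + s⁻¹ • fderiv ℝ u x) := by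
        rw [smul_add, smul_smul, mul_inv_cancel₀ hspos.ne', one_smul]
      rw [this]
      simp only [ContinuousLinearMap.det, ContinuousLinearMap.toLinearMap_smul, LinearMap.det_smul]
    · refine LipschitzOnWith.of_dist_le_mul fun x hx y hy ↦ ?_
      have := hL.dist_le_mul x hx y hy
      rw [dist_smul₀, Real.norm_of_nonneg (by positivity : 0 ≤ s⁻¹)]
      simp only [NNReal.coe_mul, Real.coe_toNNReal _ hsi, mul_assoc]
      gcongr
    · rw [← NNReal.coe_lt_coe]
      simp only [NNReal.coe_mul, Real.coe_toNNReal _ hsi, NNReal.coe_one]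
      rw [inv_mul_lt_one₀ hspos]
      have : 0 ≤ |M| / ε := by positivity
      linarith
    · intro x hx; simp [hu0 x hx]
    · intro x hx
      rw [hfd]
      apply hεdet
      rw [norm_smul, norm_inv, Real.norm_of_nonneg hspos.le, inv_mul_lt_iff₀ hspos]
      have h3 : |M| < s * ε := by
        rw [← div_lt_iff₀ hε]
        have : (0 : ℝ) ≤ L := L.2
        linarith
      exact (hM x hx).trans_lt ((le_abs_self M).trans_lt h3)
  set s : ℕ → ℝ := fun i ↦ s₀ + i with hsdef
  have hsinj : Function.Injective s := fun i j hij ↦ by simpa [s] using hij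
  have hdet1 : ∀ (t : ℝ) (A : E →L[ℝ] E), (t • ContinuousLinearMap.id ℝ E + A).det
      = LinearMap.det (t • 1 + (A : E →ₗ[ℝ] E)) := fun t A ↦ rfl
  have hsum : ∀ A : E →L[ℝ] E, (ContinuousLinearMap.id ℝ E + A).det
      = ∑ i ∈ Finset.range (finrank ℝ E + 1),
        (Lagrange.basis (Finset.range (finrank ℝ E + 1)) s i).eval 1 *
          (s i • ContinuousLinearMap.id ℝ E + A).det := fun A ↦
    LinearMap.det_one_add_eq_sum (A : E →ₗ[ℝ] E) s hsinj
  have hone := hsum 0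
  have hdet0 : ∀ t : ℝ, (t • ContinuousLinearMap.id ℝ E + 0).det = t ^ finrank ℝ E := fun t ↦ by
    rw [add_zero, ContinuousLinearMap.det, ContinuousLinearMap.toLinearMap_smul, LinearMap.det_smul]
    simp
  have h11 := hdet0 1
  rw [one_smul, one_pow] at h11
  simp only [hdet0, h11] at hone
  simp_rw [hsum]
  rw [integral_finsetSum]
  · simp_rw [integral_const_mul]
    rw [Finset.sum_congr rfl fun i _ ↦ by rw [large (s i) (by simp [s])]]
    simp_rw [← mul_assoc]
    rw [← Finset.sum_mul, ← hone, one_mul]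
  · intro i _
    refine (ContinuousOn.integrableOn_compact (isCompact_closedBall _ _) (Continuous.continuousOn ?_))
    exact continuous_const.mul (hdetc.comp (continuous_const.add hDc))

end

theorem ContDiff.exists_eq_zero_of_eq_self {d : ℕ}
    {F : EuclideanSpace ℝ (Fin d) → EuclideanSpace ℝ (Fin d)} (hF : ContDiff ℝ 1 F) {K : ℝ}
    (hK : 0 < K) (hFK : ∀ x, ‖x‖ = K → F x = x) : ∃ x, F x = 0 := by
  by_contra! hne
  set G : EuclideanSpace ℝ (Fin d) → EuclideanSpace ℝ (Fin d) := fun x ↦ (K / ‖F x‖) • F x with hG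
  have hGd : ContDiff ℝ 1 G :=
    (contDiff_const.div (hF.norm ℝ hne) fun x ↦ norm_ne_zero_iff.2 (hne x)).smul hF
  have hGn : ∀ x, ‖G x‖ = K := fun x ↦ by
    simp only [hG, norm_smul, norm_div, norm_norm, Real.norm_of_nonneg hK.le]
    exact div_mul_cancel₀ _ (norm_ne_zero_iff.2 (hne x))
  have hdet : ∀ x, (fderiv ℝ G x).det = 0 := by
    intro x
    by_contra hd
    have hsurj : Function.Surjective (fderiv ℝ G x) := by
      have hu : IsUnit (LinearMap.det (fderiv ℝ G x : EuclideanSpace ℝ (Fin d) →ₗ[ℝ] _)) :=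
        isUnit_iff_ne_zero.2 hd
      have := (LinearMap.isUnit_iff_isUnit_det _).2 hu
      exact ((Module.End.isUnit_iff _).1 this).2
    obtain ⟨v, hv⟩ := hsurj (G x)
    have h1 := ((hGd.differentiable one_ne_zero x).hasFDerivAt).norm_sq
    have h2 : HasFDerivAt (fun y ↦ ‖G y‖ ^ 2) (0 : EuclideanSpace ℝ (Fin d) →L[ℝ] ℝ) x := by
      simp only [hGn]; exact hasFDerivAt_const _ _
    have h3 := congrArg (fun L ↦ L v) (h1.unique h2)
    simp [hv, hGn] at h3
    exact hK.ne' h3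
  have h := setIntegral_det_id_add volume (u := fun x ↦ G x - x) (hGd.sub contDiff_id) (K := K)
    (fun x hx ↦ by simp [hG, hFK x hx, hx, hK.ne'])
  have h0 : ∀ x, ContinuousLinearMap.id ℝ _ + fderiv ℝ (fun x ↦ G x - x) x = fderiv ℝ G x := by
    intro x
    rw [fderiv_fun_sub (hGd.differentiable one_ne_zero x) differentiableAt_fun_id, fderiv_fun_id]
    abel
  simp only [h0, hdet, integral_zero] at h
  have hpos : 0 < volume.real (closedBall (0 : EuclideanSpace ℝ (Fin d)) K) :=
    ENNReal.toReal_pos (measure_closedBall_pos _ _ hK).ne' measure_closedBall_lt_top.ne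
  exact hpos.ne h

/-- A continuous self-map of a finite-dimensional space which is the identity outside a bounded set
is surjective. -/
theorem Continuous.surjective_of_eq_self_of_norm_ge {E : Type*} [NormedAddCommGroup E]
    [NormedSpace ℝ E] [FiniteDimensional ℝ E] {F : E → E} (hF : Continuous F) {r : ℝ}
    (hFr : ∀ x, r ≤ ‖x‖ → F x = x) : Function.Surjective F := by
  intro q
  set e : E ≃L[ℝ] EuclideanSpace ℝ (Fin (finrank ℝ E)) := toEuclidean
  set T : E →L[ℝ] EuclideanSpace ℝ (Fin (finrank ℝ E)) := e.toContinuousLinearMap with hT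
  obtain ⟨C, hC⟩ : ∃ C, ∀ y, C ≤ ‖y‖ → r ≤ ‖e.symm y + q‖ := by
    refine ⟨(‖T‖ + 1) * (|r| + ‖q‖ + 1), fun y hy ↦ ?_⟩
    by_contra! h
    have h1 : ‖e.symm y‖ ≤ |r| + ‖q‖ := by
      have : ‖e.symm y‖ ≤ ‖e.symm y + q‖ + ‖q‖ := by
        simpa using norm_sub_le (e.symm y + q) q
      linarith [le_abs_self r]
    have h2 : ‖y‖ ≤ ‖T‖ * ‖e.symm y‖ := by
      simpa [hT] using T.le_opNorm (e.symm y)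
    nlinarith [norm_nonneg T, norm_nonneg q, abs_nonneg r]
  set G : EuclideanSpace ℝ (Fin (finrank ℝ E)) → EuclideanSpace ℝ (Fin (finrank ℝ E)) :=
    fun y ↦ e (F (e.symm y + q) - q) with hG
  have hGc : Continuous G := by fun_prop
  have hGid : ∀ y, C ≤ ‖y‖ → G y = y := fun y hy ↦ by simp [hG, hFr _ (hC y hy)]
  by_contra! hq
  have hG0 : ∀ y, G y ≠ 0 := fun y hy ↦ hq (e.symm y + q) (by
    rwa [hG, e.map_eq_zero_iff, sub_eq_zero] at hy)
  obtain ⟨g, hg, hgG, hgs⟩ := (hGc.sub continuous_id).exists_contDiff_approx 1 hGc.norm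
    fun y ↦ norm_pos_iff.2 (hG0 y)
  obtain ⟨x, hx⟩ := ContDiff.exists_eq_zero_of_eq_self (contDiff_id.add hg) (K := |C| + 1)
    (by positivity) fun y hy ↦ by
      have : g y = 0 := by
        by_contra h
        exact hgs h (by simp [hGid y (by linarith [le_abs_self C])])
      simp [this]
  have h := hgG x
  simp only [id] at hx
  rw [dist_eq_norm, Pi.sub_apply, id, sub_sub_eq_add_sub, add_comm, hx, zero_sub, norm_neg] at h
  exact lt_irrefl _ h

end

section

open Set Metric Module

section
variable {E : Type*} [NormedAddCommGroup E] [InnerProductSpace ℝ E] [FiniteDimensional ℝ E]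

/-- One step of a truncated normalised gradient descent. -/
theorem exists_descent_step {Φ : E → ℝ} (hΦ : ContDiff ℝ 1 Φ) {β δ : ℝ} (hβ : 0 < β) (hδ : 0 < δ)
    (hgrad : ∀ x, β / 2 ≤ Φ x → δ ≤ ‖gradient Φ x‖) (ρ : ℝ) :
    ∃ η₀ > 0, ∀ η, 0 < η → η ≤ η₀ → ∃ h : E → E, Continuous h ∧ (∀ x, ‖h x - x‖ ≤ η) ∧
      (∀ x, Φ x ≤ 0 → h x = x) ∧ (∀ x, ‖x‖ ≤ ρ → Φ (h x) ≤ Φ x) ∧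
      (∀ x, ‖x‖ ≤ ρ → β ≤ Φ x → Φ (h x) ≤ Φ x - η * (δ / 2)) := by
  have hgc : Continuous (gradient Φ) :=
    (InnerProductSpace.toDual ℝ E).symm.continuous.comp (hΦ.continuous_fderiv one_ne_zero)
  have hgd : ∀ x, HasGradientAt Φ (gradient Φ x) x := fun x ↦
    (hΦ.differentiable one_ne_zero x).hasGradientAt
  have huc := (isCompact_closedBall (0 : E) (ρ + 1)).uniformContinuousOn_of_continuous
    hgc.continuousOn
  obtain ⟨η₁, hη₁, hη₁'⟩ := Metric.uniformContinuousOn_iff.1 huc (δ / 2) (by positivity)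
  refine ⟨min 1 (η₁ / 2), by positivity, fun η hη hηle ↦ ?_⟩
  have hη1 : η ≤ 1 := hηle.trans (min_le_left _ _)
  have hη2 : η < η₁ := (hηle.trans (min_le_right _ _)).trans_lt (half_lt_self hη₁)
  set χ : E → ℝ := fun x ↦ max 0 (min 1 ((Φ x - β / 2) / (β / 2))) with hχ
  have hχ0 : ∀ x, 0 ≤ χ x := fun x ↦ le_max_left _ _
  have hχ1 : ∀ x, χ x ≤ 1 := fun x ↦ max_le zero_le_one (min_le_left _ _)
  have hχz : ∀ x, Φ x ≤ β / 2 → χ x = 0 := fun x hx ↦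
    max_eq_left ((min_le_right _ _).trans
      (div_nonpos_of_nonpos_of_nonneg (by linarith) (by positivity)))
  have hχβ : ∀ x, β ≤ Φ x → χ x = 1 := fun x hx ↦ by
    simp only [hχ]
    rw [min_eq_left, max_eq_right zero_le_one]
    rw [le_div_iff₀ (by positivity)]; linarith
  set g := gradient Φ
  have hmax : ∀ x, 0 < max δ ‖g x‖ := fun x ↦ hδ.trans_le (le_max_left _ _)
  set h : E → E := fun x ↦ x - ((η * χ x) / max δ ‖g x‖) • g x with hh
  have hχc : Continuous χ := by
    have := hΦ.continuous
    fun_prop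
  have hsub : ∀ x, h x - x = - (((η * χ x) / max δ ‖g x‖) • g x) := fun x ↦ by simp [hh]
  have hnorm : ∀ x, ‖h x - x‖ ≤ η * χ x := fun x ↦ by
    rw [hsub, norm_neg, norm_smul, Real.norm_of_nonneg (div_nonneg (mul_nonneg hη.le (hχ0 x))
      (hmax x).le), div_mul_eq_mul_div, div_le_iff₀ (hmax x)]
    exact mul_le_mul_of_nonneg_left (le_max_right _ _) (mul_nonneg hη.le (hχ0 x))
  have hnorm' : ∀ x, ‖h x - x‖ ≤ η := fun x ↦
    (hnorm x).trans (mul_le_of_le_one_right hη.le (hχ1 x))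
  have hdec : ∀ x, ‖x‖ ≤ ρ → β / 2 < Φ x → Φ (h x) ≤ Φ x - η * χ x * (δ / 2) := by
    intro x hx hβx
    have hg := hgrad x hβx.le
    have hseg : ∀ y ∈ closedBall x η, ‖InnerProductSpace.toDual ℝ E (g y) -
        InnerProductSpace.toDual ℝ E (g x)‖ ≤ δ / 2 := by
      intro y hy
      rw [← map_sub, LinearIsometryEquiv.norm_map, ← dist_eq_norm]
      refine (hη₁' y ?_ x ?_ (lt_of_le_of_lt hy hη2)).le
      · rw [mem_closedBall_zero_iff]
        rw [mem_closedBall_iff_norm] at hy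
        have := norm_le_norm_add_norm_sub' y x
        linarith
      · rw [mem_closedBall_zero_iff]; linarith
    have hmv := (convex_closedBall x η).norm_image_sub_le_of_norm_hasFDerivWithin_le'
      (fun y _ ↦ (hgd y).hasFDerivAt.hasFDerivWithinAt) hseg (mem_closedBall_self hη.le)
      (show h x ∈ closedBall x η by rw [mem_closedBall_iff_norm]; exact hnorm' x)
    rw [InnerProductSpace.toDual_apply_apply, hsub, inner_neg_right, inner_smul_right,
      real_inner_self_eq_norm_sq, max_eq_right hg, norm_neg, norm_smul, norm_div, norm_norm,
      div_mul_cancel₀ _ (hδ.trans_le hg).ne', Real.norm_of_nonneg (mul_nonneg hη.le (hχ0 x)),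
      Real.norm_eq_abs] at hmv
    have h2 : η * χ x / ‖g x‖ * ‖g x‖ ^ 2 = η * χ x * ‖g x‖ := by
      have := (hδ.trans_le hg).ne'
      field_simp
    rw [h2] at hmv
    have h3 := (abs_le.1 hmv).2
    have h4 : η * χ x * δ ≤ η * χ x * ‖g x‖ :=
      mul_le_mul_of_nonneg_left hg (mul_nonneg hη.le (hχ0 x))
    linarith
  have hfix : ∀ x, Φ x ≤ β / 2 → h x = x := fun x hx ↦ by simp [hh, hχz x hx]
  refine ⟨h, ?_, hnorm', fun x hx ↦ hfix x (by linarith), fun x hx ↦ ?_, fun x hx hβx ↦ ?_⟩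
  · refine continuous_id.sub (((continuous_const.mul hχc).div ?_ fun x ↦ (hmax x).ne').smul hgc)
    exact continuous_const.max hgc.norm
  · rcases le_or_gt (Φ x) (β / 2) with hle | hlt
    · rw [hfix x hle]
    · have := hdec x hx hlt
      have h1 : 0 ≤ η * χ x * (δ / 2) :=
        mul_nonneg (mul_nonneg hη.le (hχ0 x)) (by positivity)
      linarith
  · have := hdec x hx (by linarith)
    rwa [hχβ x hβx, mul_one] at this

/-- A continuous map fixing `V` and the far part of the half-space `V + ℝ≥0 e` sends some point of
this half-space to the sphere of radius `α` in `Vᗮ`. -/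
theorem exists_map_mem_orthogonal_sphere (V : Submodule ℝ E) {e : E} (heV : e ∈ Vᗮ)
    (he : ‖e‖ = 1) {γ : E → E} (hγ : Continuous γ) {α r : ℝ} (hα : 0 < α)
    (hγV : ∀ v ∈ V, γ v = v)
    (hγr : ∀ v ∈ V, ∀ s : ℝ, 0 ≤ s → r ≤ ‖v + s • e‖ → γ (v + s • e) = v + s • e) :
    ∃ v ∈ V, ∃ s : ℝ, 0 ≤ s ∧ γ (v + s • e) ∈ Vᗮ ∧ ‖γ (v + s • e)‖ = α := by
  set P : E →L[ℝ] V := V.orthogonalProjectionOnto with hP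
  set Q : E → E := fun x ↦ x - (P x : E) with hQ
  have hPv : ∀ (v : V) (s : ℝ), P (v + s • e) = v := fun v s ↦ by
    simp [hP, heV]
  have hQv : ∀ (v : V) (s : ℝ), Q (v + s • e) = s • e := fun v s ↦ by simp [hQ, hPv]
  set y : V × ℝ → E := fun p ↦ p.1 + (max p.2 0) • e with hy
  set T : V × ℝ → V × ℝ := fun p ↦ (P (γ (y p)), ‖Q (γ (y p))‖ + min p.2 0) with hT
  have hyc : Continuous y := by fun_prop
  have hQc : Continuous Q := by fun_prop
  have hTc : Continuous T := by fun_prop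
  have hTid : ∀ p, γ (y p) = y p → T p = p := by
    rintro ⟨v, s⟩ hp
    simp only [hT, hp]
    simp only [hy]
    rw [hPv, hQv, norm_smul, he, mul_one, Real.norm_of_nonneg (le_max_right _ _), max_add_min,
      add_zero]
  have hneg : ∀ p : V × ℝ, p.2 ≤ 0 → γ (y p) = y p := fun p hp ↦ by
    simp only [hy, max_eq_right hp, zero_smul, add_zero]; exact hγV _ p.1.2
  have hlarge : ∀ p : V × ℝ, |r| ≤ ‖p‖ → T p = p := by
    intro p hp
    apply hTid
    rcases le_or_gt p.2 0 with hs | hs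
    · exact hneg p hs
    · simp only [hy, max_eq_left hs.le]
      refine hγr _ p.1.2 _ hs.le ((le_abs_self r).trans (hp.trans ?_))
      have hi : inner ℝ (p.1 : E) (p.2 • e) = 0 :=
        Submodule.inner_right_of_mem_orthogonal p.1.2 (Vᗮ.smul_mem _ heV)
      have hsq := norm_add_sq_eq_norm_sq_add_norm_sq_real hi
      rw [norm_smul, he, mul_one] at hsq
      rw [Prod.norm_def, max_le_iff]
      constructor
      · refine abs_le_of_sq_le_sq' ?_ (norm_nonneg _) |>.2
        have : ‖p.1‖ = ‖(p.1 : E)‖ := rfl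
        rw [this]; nlinarith [mul_self_nonneg ‖p.2‖]
      · refine abs_le_of_sq_le_sq' ?_ (norm_nonneg _) |>.2
        nlinarith [mul_self_nonneg ‖(p.1 : E)‖]
  obtain ⟨p, hp⟩ := hTc.surjective_of_eq_self_of_norm_ge hlarge (0, α)
  have hs : 0 ≤ p.2 := by
    by_contra! hs
    rw [hTid p (hneg p hs.le)] at hp
    rw [hp] at hs
    exact hα.not_gt hs
  have hy' : y p = p.1 + p.2 • e := by simp only [hy, max_eq_left hs]
  simp only [hT, Prod.mk.injEq, min_eq_right hs, add_zero, hQ] at hp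
  obtain ⟨hp1, hp2⟩ := hp
  rw [hp1] at hp2
  refine ⟨p.1, p.1.2, p.2, hs, ?_, ?_⟩
  · rw [← hy']; simpa [hP] using hp1
  · rw [← hy']; simpa using hp2

/-- A linking theorem: a `C¹` function on a finite-dimensional space has points of positive level
with arbitrarily small gradient. -/
theorem exists_gradient_lt_of_linking {Φ : E → ℝ} (hΦ : ContDiff ℝ 1 Φ) (V : Submodule ℝ E) {e : E}
    (heV : e ∈ Vᗮ) (he : ‖e‖ = 1) {α β r : ℝ} (hα : 0 < α) (hβ : 0 < β)
    (hV : ∀ v ∈ V, Φ v ≤ 0)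
    (hr : ∀ v ∈ V, ∀ s : ℝ, 0 ≤ s → r ≤ ‖v + s • e‖ → Φ (v + s • e) ≤ 0)
    (hW : ∀ w ∈ Vᗮ, ‖w‖ = α → β ≤ Φ w) {δ : ℝ} (hδ : 0 < δ) :
    ∃ x, β / 2 ≤ Φ x ∧ ‖gradient Φ x‖ < δ := by
  by_contra! hgrad
  obtain ⟨M, hM⟩ := (isCompact_closedBall (0 : E) |r|).exists_bound_of_continuousOn
    hΦ.continuous.continuousOn
  set l : ℝ := 2 * |M| / δ + 1
  have hl : 0 < l := by positivity
  obtain ⟨η₀, hη₀, hstep⟩ := exists_descent_step hΦ hβ hδ hgrad (|r| + l)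
  obtain ⟨n, hn⟩ := exists_nat_gt (l / η₀)
  have hn0 : (0 : ℝ) < n := (by positivity : 0 < l / η₀).trans hn
  obtain ⟨h, hc, hnorm, hfix, hle, hdec⟩ := hstep (l / n) (by positivity) (by
    rw [div_lt_iff₀ hη₀] at hn
    rw [div_le_iff₀ hn0]; linarith)
  have hiter0 : ∀ (k : ℕ) x, Φ x ≤ 0 → h^[k] x = x := fun k x hx ↦
    Function.iterate_fixed (hfix x hx) k
  obtain ⟨v, hv, s, hs, h1, h2⟩ := exists_map_mem_orthogonal_sphere V heV he (hc.iterate n) hα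
    (fun v hv ↦ hiter0 n v (hV v hv)) (fun v hv s hs hn ↦ hiter0 n _ (hr v hv s hs hn))
  have h3 := hW _ h1 h2
  set x := v + s • e
  have hxr : ‖x‖ ≤ |r| := by
    by_contra! hlt
    have h0 := hr v hv s hs ((le_abs_self r).trans hlt.le)
    rw [hiter0 n _ h0] at h3
    linarith
  have hxn : ∀ k ≤ n, ‖h^[k] x‖ ≤ |r| + k * (l / n) := by
    intro k hk
    induction k with
    | zero => simpa using hxr
    | succ k ih =>
      rw [Function.iterate_succ_apply']
      have := norm_le_norm_add_norm_sub' (h (h^[k] x)) (h^[k] x)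
      have := hnorm (h^[k] x)
      have := ih (by omega)
      push_cast
      linarith
  have hxn' : ∀ k ≤ n, ‖h^[k] x‖ ≤ |r| + l := fun k hk ↦ by
    refine (hxn k hk).trans ?_
    have : (k : ℝ) * (l / n) ≤ n * (l / n) := by gcongr
    rw [mul_div_cancel₀ _ hn0.ne'] at this
    linarith
  have hlevel : ∀ k ≤ n, Φ (h^[k] x) < β ∨ Φ (h^[k] x) ≤ Φ x - k * (l / n * (δ / 2)) := by
    intro k hk
    induction k with
    | zero => right; simp
    | succ k ih =>
      rw [Function.iterate_succ_apply']
      rcases lt_or_ge (Φ (h^[k] x)) β with hlt | hge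
      · left; exact (hle _ (hxn' k (by omega))).trans_lt hlt
      · right
        have h4 := (ih (by omega)).resolve_left hge.not_gt
        have := hdec _ (hxn' k (by omega)) hge
        push_cast
        linarith
  have h5 := (hlevel n le_rfl).resolve_left h3.not_gt
  have h6 := hM x (by simpa using hxr)
  have h7 : (n : ℝ) * (l / n * (δ / 2)) = |M| + δ / 2 := by
    simp only [l]; field_simp
  have := le_abs_self M
  have := le_abs_self (Φ x)
  rw [Real.norm_eq_abs] at h6
  linarith

end

end

section

open Set Metric Module MeasureTheory AddCircle
open scoped ComplexConjugate

theorem hasFDerivAt_integral_unitAddCircle {E : Type*} [NormedAddCommGroup E] [NormedSpace ℝ E]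
    [FiniteDimensional ℝ E] {F : E → UnitAddCircle → ℝ} {F' : E → UnitAddCircle → E →L[ℝ] ℝ}
    (hF : Continuous F.uncurry) (hF' : Continuous F'.uncurry)
    (h : ∀ x t, HasFDerivAt (F · t) (F' x t) x) (x : E) :
    HasFDerivAt (fun x ↦ ∫ t, F x t ∂haarAddCircle) (∫ t, F' x t ∂haarAddCircle) x := by
  have := FiniteDimensional.proper_real E
  obtain ⟨M, hM⟩ := ((isCompact_closedBall x 1).prod
    (isCompact_univ (X := UnitAddCircle))).bddAbove_image hF'.norm.continuousOn
  refine hasFDerivAt_integral_of_dominated_of_fderiv_le (bound := fun _ ↦ M)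
    (closedBall_mem_nhds x one_pos) ?_ ?_ ?_ ?_ (integrable_const _) ?_
  · exact .of_forall fun y ↦ Continuous.aestronglyMeasurable (by fun_prop)
  · exact Continuous.integrable_of_hasCompactSupport (by fun_prop) (HasCompactSupport.of_compactSpace _)
  · exact Continuous.aestronglyMeasurable (by fun_prop)
  · exact .of_forall fun t y hy ↦ hM ⟨(y, t), ⟨hy, mem_univ _⟩, rfl⟩
  · exact .of_forall fun t y _ ↦ h y t

theorem contDiff_integral_unitAddCircle {E : Type*} [NormedAddCommGroup E] [NormedSpace ℝ E]
    [FiniteDimensional ℝ E] {F : E → UnitAddCircle → ℝ} {F' : E → UnitAddCircle → E →L[ℝ] ℝ}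
    (hF : Continuous F.uncurry) (hF' : Continuous F'.uncurry)
    (h : ∀ x t, HasFDerivAt (F · t) (F' x t) x) :
    ContDiff ℝ 1 (fun x ↦ ∫ t, F x t ∂haarAddCircle) := by
  have := FiniteDimensional.proper_real E
  have key := hasFDerivAt_integral_unitAddCircle hF hF' h
  refine contDiff_one_iff_fderiv.2 ⟨fun x ↦ (key x).differentiableAt, ?_⟩
  rw [show fderiv ℝ _ = _ from funext fun x ↦ (key x).fderiv]
  simpa using continuous_parametric_integral_of_continuous (μ := haarAddCircle) hF' isCompact_univ

theorem integral_fourier (n : ℤ) :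
    ∫ t : UnitAddCircle, fourier n t ∂haarAddCircle = if n = 0 then 1 else 0 := by
  split_ifs with h
  · simp [h]
  · exact integral_eq_zero_of_add_right_eq_neg (μ := haarAddCircle)
      (fourier_add_half_inv_index h one_pos)

theorem Continuous.integrable_haar {E : Type*} [NormedAddCommGroup E] {f : UnitAddCircle → E}
    (hf : Continuous f) : Integrable f haarAddCircle :=
  hf.integrable_of_hasCompactSupport (HasCompactSupport.of_compactSpace _)

section
variable {X : Type*} [NormedAddCommGroup X] [InnerProductSpace ℝ X]

/-- The action of a complex number on a real vector space with a complex structure `J`. -/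
noncomputable def cact (J : X →L[ℝ] X) (z : ℂ) (v : X) : X := z.re • v + z.im • J v

theorem map_cact {J T : X →L[ℝ] X} (hT : ∀ x, T (J x) = J (T x)) (z : ℂ) (v : X) :
    T (cact J z v) = cact J z (T v) := by
  simp [cact, hT]

theorem cact_sub_left (J : X →L[ℝ] X) (z w : ℂ) (v : X) :
    cact J (z - w) v = cact J z v - cact J w v := by
  simp only [cact, Complex.sub_re, Complex.sub_im]; module

theorem cact_mul {J : X →L[ℝ] X} (hJ2 : ∀ x, J (J x) = -x) (z w : ℂ) (v : X) :
    cact J (z * w) v = cact J z (cact J w v) := by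
  simp only [cact, Complex.mul_re, Complex.mul_im, map_add, map_smul, hJ2]; module

theorem inner_cact {J : X →L[ℝ] X} (hJ : ∀ x y, inner ℝ (J x) y = -inner ℝ x (J y)) (z : ℂ)
    (v w : X) : inner ℝ (cact J z v) w = inner ℝ v (cact J (conj z) w) := by
  simp only [cact, inner_add_left, inner_add_right, real_inner_smul_left, real_inner_smul_right, hJ,
    Complex.conj_re, Complex.conj_im]
  ring

theorem norm_cact {J : X →L[ℝ] X} (hJ : ∀ x y, inner ℝ (J x) y = -inner ℝ x (J y))
    (hJ2 : ∀ x, J (J x) = -x) (z : ℂ) (v : X) : ‖cact J z v‖ = ‖z‖ * ‖v‖ := by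
  rw [← sq_eq_sq₀ (norm_nonneg _) (by positivity), ← real_inner_self_eq_norm_sq, inner_cact hJ,
    ← cact_mul hJ2, mul_pow, ← Complex.normSq_eq_norm_sq, ← Complex.normSq_eq_conj_mul_self]
  simp [cact, real_inner_smul_right]

/-- The trigonometric loop with Fourier coefficients `x`. -/
noncomputable def trigLoop (J : X →L[ℝ] X) {s : Finset ℤ} (t : UnitAddCircle) :
    PiLp 2 (fun _ : s ↦ X) →L[ℝ] X :=
  ∑ j : s, ((fourier (j : ℤ) t : ℂ).re • ContinuousLinearMap.id ℝ X
    + (fourier (j : ℤ) t : ℂ).im • J) ∘L PiLp.proj 2 (fun _ : s ↦ X) j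

theorem trigLoop_apply (J : X →L[ℝ] X) {s : Finset ℤ} (t : UnitAddCircle)
    (x : PiLp 2 (fun _ : s ↦ X)) : trigLoop J t x = ∑ j : s, cact J (fourier (j : ℤ) t) (x j) := by
  simp [trigLoop, cact]

theorem continuous_trigLoop (J : X →L[ℝ] X) {s : Finset ℤ} : Continuous (trigLoop J (s := s)) := by
  unfold trigLoop; fun_prop

theorem integral_inner_trigLoop {J : X →L[ℝ] X} (hJ : ∀ x y, inner ℝ (J x) y = -inner ℝ x (J y))
    (hJ2 : ∀ x, J (J x) = -x) {s : Finset ℤ} (x y : PiLp 2 (fun _ : s ↦ X)) :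
    ∫ t, inner ℝ (trigLoop J t x) (trigLoop J t y) ∂haarAddCircle = inner ℝ x y := by
  have key (i j : ℤ) (v w : X) : ∫ t : UnitAddCircle,
      inner ℝ (cact J (fourier i t) v) (cact J (fourier j t) w) ∂haarAddCircle
        = if i = j then inner ℝ v w else 0 := by
    have (t : UnitAddCircle) : inner ℝ (cact J (fourier i t) v) (cact J (fourier j t) w)
        = (fourier (j - i) t : ℂ).re * inner ℝ v w + (fourier (j - i) t : ℂ).im * inner ℝ v (J w) := by
      rw [inner_cact hJ, ← cact_mul hJ2, ← fourier_neg, ← fourier_add, ← sub_eq_neg_add]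
      simp [cact, inner_add_right, real_inner_smul_right]
    have hi : Integrable (fun t : UnitAddCircle ↦ (fourier (j - i) t : ℂ)) haarAddCircle :=
      (map_continuous _).integrable_haar
    have hre : Integrable (fun t : UnitAddCircle ↦ (fourier (j - i) t : ℂ).re) haarAddCircle := hi.re
    have him : Integrable (fun t : UnitAddCircle ↦ (fourier (j - i) t : ℂ).im) haarAddCircle := hi.im
    simp_rw [this]
    rw [integral_add (hre.mul_const _) (him.mul_const _), integral_mul_const, integral_mul_const]
    have h1 := integral_re hi
    have h2 := integral_im hi
    simp only [RCLike.re_eq_complex_re, RCLike.im_eq_complex_im] at h1 h2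
    rw [h1, h2, integral_fourier]
    by_cases h : i = j
    · simp [h]
    · simp [h, sub_eq_zero, Ne.symm h]
  have hc (i : ℤ) (v : X) : Continuous fun t : UnitAddCircle ↦ cact J (fourier i t) v := by
    unfold cact; fun_prop
  have hi (i j : ℤ) (v w : X) : Integrable (fun t : UnitAddCircle ↦
      inner ℝ (cact J (fourier i t) v) (cact J (fourier j t) w)) haarAddCircle :=
    ((hc _ _).inner (hc _ _)).integrable_haar
  simp_rw [trigLoop_apply, sum_inner, inner_sum]
  rw [integral_finsetSum _ fun i _ ↦ integrable_finsetSum _ fun j _ ↦ hi _ _ _ _, PiLp.inner_apply]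
  refine Finset.sum_congr rfl fun i _ ↦ ?_
  rw [integral_finsetSum _ fun j _ ↦ hi _ _ _ _]
  simp_rw [key]
  simp

theorem trigLoop_single (J : X →L[ℝ] X) {s : Finset ℤ} (t : UnitAddCircle) (j : s) (v : X) :
    trigLoop J t (WithLp.toLp 2 (Pi.single j v)) = cact J (fourier (j : ℤ) t) v := by
  rw [trigLoop_apply, Finset.sum_eq_single j]
  · simp
  · intro i _ hi
    simp [Pi.single_eq_of_ne hi, cact]
  · simp

theorem map_trigLoop {J T : X →L[ℝ] X} (hT : ∀ x, T (J x) = J (T x)) {s : Finset ℤ}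
    (t : UnitAddCircle) (x : PiLp 2 (fun _ : s ↦ X)) :
    T (trigLoop J t x) = trigLoop J t (WithLp.toLp 2 fun j ↦ T (x j)) := by
  simp [trigLoop_apply, map_cact hT]

theorem norm_trigLoop_le {J : X →L[ℝ] X} (hJ : ∀ x y, inner ℝ (J x) y = -inner ℝ x (J y))
    (hJ2 : ∀ x, J (J x) = -x) {s : Finset ℤ} (t : UnitAddCircle) (x : PiLp 2 (fun _ : s ↦ X)) :
    ‖trigLoop J t x‖ ≤ ∑ j, ‖x j‖ := by
  rw [trigLoop_apply]
  refine (norm_sum_le _ _).trans (Finset.sum_le_sum fun j _ ↦ ?_)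
  rw [norm_cact hJ hJ2, fourier_apply, Circle.norm_coe, one_mul]

/-- The Hamiltonian action functional on trigonometric loops. -/
noncomputable def loopAction (J : X →L[ℝ] X) (H : X → ℝ) (s : Finset ℤ)
    (x : PiLp 2 (fun _ : s ↦ X)) : ℝ :=
  ∑ j : s, Real.pi * (j : ℤ) * ‖x j‖ ^ 2 - ∫ t, H (trigLoop J t x) ∂haarAddCircle

theorem hasFDerivAt_comp_trigLoop (J : X →L[ℝ] X) [FiniteDimensional ℝ X] {H : X → ℝ} {g : X → X}
    (hg : ∀ x, HasGradientAt H (g x) x) {s : Finset ℤ} (x : PiLp 2 (fun _ : s ↦ X))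
    (t : UnitAddCircle) : HasFDerivAt (fun x ↦ H (trigLoop J t x))
      (innerSL ℝ (g (trigLoop J t x)) ∘L trigLoop J (s := s) t) x :=
  (hg _).hasFDerivAt.comp x (trigLoop J t).hasFDerivAt

theorem contDiff_loopAction (J : X →L[ℝ] X) [FiniteDimensional ℝ X] {H : X → ℝ} {g : X → X}
    (hg : ∀ x, HasGradientAt H (g x) x) (hgc : Continuous g) (s : Finset ℤ) :
    ContDiff ℝ 1 (loopAction J H s) := by
  have hH : Continuous H := continuous_iff_continuousAt.2 fun x ↦ (hg x).hasFDerivAt.continuousAt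
  have hl := continuous_trigLoop J (s := s)
  refine ContDiff.sub (ContDiff.sum fun j _ ↦ contDiff_const.mul
    ((PiLp.proj 2 (fun _ : s ↦ X) j).contDiff.norm_sq ℝ)) (contDiff_integral_unitAddCircle
    (F' := fun x t ↦ innerSL ℝ (g (trigLoop J t x)) ∘L trigLoop J (s := s) t) ?_ ?_
    fun x t ↦ hasFDerivAt_comp_trigLoop J hg x t)
  · exact hH.comp (by fun_prop)
  · exact (((innerSL ℝ).continuous.comp (hgc.comp (by fun_prop)))).clm_comp (by fun_prop)

theorem fderiv_loopAction (J : X →L[ℝ] X) [FiniteDimensional ℝ X] {H : X → ℝ} {g : X → X}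
    (hg : ∀ x, HasGradientAt H (g x) x) (hgc : Continuous g) (s : Finset ℤ)
    (x y : PiLp 2 (fun _ : s ↦ X)) :
    fderiv ℝ (loopAction J H s) x y = ∑ j : s, 2 * Real.pi * (j : ℤ) * inner ℝ (x j) (y j)
      - ∫ t, inner ℝ (g (trigLoop J t x)) (trigLoop J t y) ∂haarAddCircle := by
  have hH : Continuous H := continuous_iff_continuousAt.2 fun x ↦ (hg x).hasFDerivAt.continuousAt
  have hl := continuous_trigLoop J (s := s)
  have hc : Continuous (fun p : PiLp 2 (fun _ : s ↦ X) × UnitAddCircle ↦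
      innerSL ℝ (g (trigLoop J p.2 p.1)) ∘L trigLoop J (s := s) p.2) :=
    (((innerSL ℝ).continuous.comp (hgc.comp (by fun_prop)))).clm_comp (by fun_prop)
  have h1 := hasFDerivAt_integral_unitAddCircle
    (F := fun x t ↦ H (trigLoop J t x))
    (F' := fun x t ↦ innerSL ℝ (g (trigLoop J t x)) ∘L trigLoop J (s := s) t)
    (hH.comp (by fun_prop)) hc (fun x t ↦ hasFDerivAt_comp_trigLoop J hg x t) x
  have h2 (j : s) : HasFDerivAt (fun x : PiLp 2 (fun _ : s ↦ X) ↦ Real.pi * (j : ℤ) * ‖x j‖ ^ 2)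
      ((Real.pi * (j : ℤ)) • ((2 : ℕ) • innerSL ℝ (x j) ∘L PiLp.proj 2 (fun _ : s ↦ X) j)) x :=
    (((PiLp.proj 2 (fun _ : s ↦ X) j).hasFDerivAt (x := x)).norm_sq).const_mul _
  have h3 := (HasFDerivAt.fun_sum (u := Finset.univ) fun j _ ↦ h2 j).sub h1
  have h4 : fderiv ℝ (loopAction J H s) x = _ := h3.fderiv
  rw [h4, sub_apply, ContinuousLinearMap.integral_apply]
  · simp [mul_assoc, mul_left_comm]
  · exact (hc.comp (by fun_prop : Continuous fun t ↦ (x, t))).integrable_haar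

end

end

section

open Set Metric Module MeasureTheory AddCircle
open scoped ComplexConjugate

section
variable {X : Type*} [NormedAddCommGroup X] [InnerProductSpace ℝ X]

theorem loopAction_nonpos (J : X →L[ℝ] X) {H : X → ℝ} (hH : ∀ x, 0 ≤ H x) {s : Finset ℤ}
    {x : PiLp 2 (fun _ : s ↦ X)} (hx : ∀ j : s, 0 < (j : ℤ) → x j = 0) :
    loopAction J H s x ≤ 0 := by
  have h1 : ∑ j : s, Real.pi * (j : ℤ) * ‖x j‖ ^ 2 ≤ 0 := by
    refine Finset.sum_nonpos fun j _ ↦ ?_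
    by_cases hj : 0 < (j : ℤ)
    · simp [hx j hj]
    · have : ((j : ℤ) : ℝ) ≤ 0 := by exact_mod_cast not_lt.1 hj
      have : Real.pi * (j : ℤ) ≤ 0 := mul_nonpos_of_nonneg_of_nonpos Real.pi_pos.le this
      exact mul_nonpos_of_nonpos_of_nonneg this (by positivity)
  have h2 : 0 ≤ ∫ t, H (trigLoop J t x) ∂haarAddCircle := integral_nonneg fun t ↦ hH _
  unfold loopAction
  linarith

theorem loopAction_le {J : X →L[ℝ] X} (hJ : ∀ x y, inner ℝ (J x) y = -inner ℝ x (J y))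
    (hJ2 : ∀ x, J (J x) = -x) {B : X →L[ℝ] X} (hBJ : ∀ x, B (J x) = J (B x)) {H : X → ℝ}
    (hHc : Continuous H) {c : X} {C₂ : ℝ} (hH : ∀ x, inner ℝ (B (x - c)) (x - c) - C₂ ≤ H x)
    {s : Finset ℤ} (h0 : 0 ∈ s) (x : PiLp 2 (fun _ : s ↦ X)) :
    loopAction J H s (x + WithLp.toLp 2 (Pi.single ⟨0, h0⟩ c))
      ≤ ∑ j : s, (Real.pi * (j : ℤ) * ‖x j‖ ^ 2 - inner ℝ (B (x j)) (x j)) + C₂ := by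
  have hl := continuous_trigLoop J (s := s)
  have h1 : ∫ t, (inner ℝ (trigLoop J t (WithLp.toLp 2 fun j : s ↦ B (x j))) (trigLoop J t x) - C₂)
      ∂haarAddCircle
      ≤ ∫ t, H (trigLoop J t (x + WithLp.toLp 2 (Pi.single ⟨0, h0⟩ c))) ∂haarAddCircle := by
    refine integral_mono (Continuous.integrable_haar (by fun_prop))
      (Continuous.integrable_haar (by fun_prop)) fun t ↦ ?_
    have h2 := hH (trigLoop J t (x + WithLp.toLp 2 (Pi.single ⟨0, h0⟩ c)))
    rw [map_add, trigLoop_single, fourier_zero] at h2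
    simp only [cact, Complex.one_re, Complex.one_im, one_smul, zero_smul, add_zero,
      add_sub_cancel_right] at h2
    simpa only [map_add, trigLoop_single, fourier_zero, cact, Complex.one_re, Complex.one_im,
      one_smul, zero_smul, add_zero, ← map_trigLoop hBJ] using h2
  rw [integral_sub (Continuous.integrable_haar (by fun_prop)) (integrable_const _),
    integral_inner_trigLoop hJ hJ2, PiLp.inner_apply] at h1
  have h3 : ∑ j : s, Real.pi * (j : ℤ) * 
      ‖(x + WithLp.toLp 2 (Pi.single ⟨0, h0⟩ c) : PiLp 2 (fun _ : s ↦ X)) j‖ ^ 2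
      = ∑ j : s, Real.pi * (j : ℤ) * ‖x j‖ ^ 2 := by
    refine Finset.sum_congr rfl fun j _ ↦ ?_
    by_cases hj : j = ⟨0, h0⟩
    · simp [hj]
    · simp [hj]
  unfold loopAction
  rw [h3, Finset.sum_sub_distrib]
  simp only [integral_const, probReal_univ, smul_eq_mul, one_mul] at h1
  linarith

theorem le_loopAction {J : X →L[ℝ] X} (hJ : ∀ x y, inner ℝ (J x) y = -inner ℝ x (J y))
    (hJ2 : ∀ x, J (J x) = -x) {H : X → ℝ} (hHc : Continuous H) {ρ C₃ : ℝ}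
    (hC₃ : 0 ≤ C₃) (hρ : ∀ x, ‖x‖ < ρ → H x = 0) (hH : ∀ x, H x ≤ C₃ * ‖x‖ ^ 2) {m : ℕ}
    (hm : 4 * C₃ ≤ Real.pi * m) {α : ℝ} (hα : m * α ≤ ρ / 2) (hα0 : 0 ≤ α) {s : Finset ℤ}
    {x : PiLp 2 (fun _ : s ↦ X)} (hx : ∀ j : s, (j : ℤ) ≤ 0 → x j = 0) (hxα : ‖x‖ = α) :
    Real.pi * α ^ 2 ≤ loopAction J H s x := by
  have hl := continuous_trigLoop J (s := s)
  let y : PiLp 2 (fun _ : s ↦ X) := WithLp.toLp 2 fun j ↦ if (j : ℤ) ≤ m then 0 else x j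
  have hlow (t) : ‖trigLoop J t (x - y)‖ ≤ ρ / 2 := by
    refine (norm_trigLoop_le hJ hJ2 t _).trans (le_trans ?_ hα)
    have h1 : ∀ j ∈ Finset.univ (α := s), ‖(x - y) j‖
        ≤ (fun j : ℤ ↦ if j ∈ Finset.Ioc (0 : ℤ) m then α else 0) j := by
      intro j _
      simp only [y, PiLp.sub_apply, Finset.mem_Ioc]
      by_cases hj : (j : ℤ) ≤ m
      · by_cases hj0 : 0 < (j : ℤ)
        · simpa [hj, hj0, hxα] using PiLp.norm_apply_le x j
        · simp [hj, hj0, hx j (not_lt.1 hj0)]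
      · simp [hj]
    refine (Finset.sum_le_sum h1).trans ?_
    rw [Finset.sum_coe_sort s (fun j : ℤ ↦ if j ∈ Finset.Ioc (0 : ℤ) m then α else 0),
      ← Finset.sum_filter, Finset.sum_const, nsmul_eq_mul]
    refine mul_le_mul_of_nonneg_right ?_ hα0
    have := Finset.card_le_card (s := s.filter (· ∈ Finset.Ioc (0 : ℤ) m))
      (t := Finset.Ioc (0 : ℤ) m) fun j hj ↦ (Finset.mem_filter.1 hj).2
    simp only [Int.card_Ioc, sub_zero, Int.toNat_natCast] at this
    exact_mod_cast this
  have hpt (t) : H (trigLoop J t x) ≤ 4 * C₃ * inner ℝ (trigLoop J t y) (trigLoop J t y) := by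
    rw [real_inner_self_eq_norm_sq]
    by_cases ht : ‖trigLoop J t x‖ < ρ
    · rw [hρ _ ht]; positivity
    · have h1 : ‖trigLoop J t x‖ ≤ ‖trigLoop J t (x - y)‖ + ‖trigLoop J t y‖ := by
        simpa [← map_add] using norm_add_le (trigLoop J t (x - y)) (trigLoop J t y)
      have h2 := hlow t
      have h3 : ‖trigLoop J t x‖ ≤ 2 * ‖trigLoop J t y‖ := by linarith [not_lt.1 ht]
      refine (hH _).trans ?_
      have : ‖trigLoop J t x‖ ^ 2 ≤ (2 * ‖trigLoop J t y‖) ^ 2 := by gcongr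
      nlinarith
  have h1 : ∫ t, H (trigLoop J t x) ∂haarAddCircle
      ≤ ∫ t, 4 * C₃ * inner ℝ (trigLoop J t y) (trigLoop J t y) ∂haarAddCircle :=
    integral_mono (Continuous.integrable_haar (by fun_prop))
      (Continuous.integrable_haar (by fun_prop)) hpt
  rw [integral_const_mul, integral_inner_trigLoop hJ hJ2, PiLp.inner_apply, Finset.mul_sum] at h1
  have h2 : Real.pi * α ^ 2 ≤ ∑ j : s, (Real.pi * (j : ℤ) * ‖x j‖ ^ 2
      - 4 * C₃ * inner ℝ (y j) (y j)) := by
    rw [← hxα, PiLp.norm_sq_eq_of_L2, Finset.mul_sum]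
    refine Finset.sum_le_sum fun j _ ↦ ?_
    by_cases hj0 : (j : ℤ) ≤ 0
    · simp [y, hx j hj0]
    · have hj1 : (1 : ℝ) ≤ (j : ℤ) := by exact_mod_cast Int.not_le.1 hj0
      by_cases hj : (j : ℤ) ≤ m
      · simp only [y, hj, if_true, inner_zero_left, mul_zero, sub_zero]
        exact mul_le_mul_of_nonneg_right (le_mul_of_one_le_right Real.pi_pos.le hj1) (by positivity)
      · have hj2 : (m : ℝ) + 1 ≤ (j : ℤ) := by exact_mod_cast Int.not_le.1 hj
        simp only [y, hj, if_false, real_inner_self_eq_norm_sq, ← sub_mul]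
        exact mul_le_mul_of_nonneg_right (by nlinarith [Real.pi_pos]) (by positivity)
  unfold loopAction
  rw [Finset.sum_sub_distrib] at h2
  linarith


/-- Trigonometric loops of large action which are almost critical for the action functional. -/
theorem exists_gradient_loopAction_lt [FiniteDimensional ℝ X] {J : X →L[ℝ] X}
    (hJ : ∀ x y, inner ℝ (J x) y = -inner ℝ x (J y)) (hJ2 : ∀ x, J (J x) = -x) {B : X →L[ℝ] X}
    (hBJ : ∀ x, B (J x) = J (B x)) {e : X} (he : ‖e‖ = 1) {a : ℝ} (hBe : B e = a • e)
    (ha : Real.pi < a) {δ₀ : ℝ} (hδ₀ : 0 < δ₀) (hBδ : ∀ x, δ₀ * ‖x‖ ^ 2 ≤ inner ℝ (B x) x)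
    {H : X → ℝ} {g : X → X} (hg : ∀ x, HasGradientAt H (g x) x) (hgc : Continuous g)
    (hH0 : ∀ x, 0 ≤ H x) {ρ : ℝ} (hρ0 : 0 < ρ) (hρ : ∀ x, ‖x‖ < ρ → H x = 0) {c : X} {C₂ : ℝ}
    (hC₂ : 0 ≤ C₂) (hHl : ∀ x, inner ℝ (B (x - c)) (x - c) - C₂ ≤ H x) {C₃ : ℝ} (hC₃ : 0 ≤ C₃)
    (hHu : ∀ x, H x ≤ C₃ * ‖x‖ ^ 2) :
    ∃ β > 0, ∀ s : Finset ℤ, 0 ∈ s → 1 ∈ s → ∀ δ > 0,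
      ∃ x, β ≤ loopAction J H s x ∧ ‖gradient (loopAction J H s) x‖ < δ := by
  have hHc : Continuous H := continuous_iff_continuousAt.2 fun x ↦ (hg x).hasFDerivAt.continuousAt
  obtain ⟨m, hm⟩ := exists_nat_gt (4 * C₃ / Real.pi)
  rw [div_lt_iff₀ Real.pi_pos, mul_comm] at hm
  let α : ℝ := ρ / 2 / (m + 1)
  have hα : 0 < α := by positivity
  have hmα : m * α ≤ ρ / 2 := by
    simp only [α]
    rw [mul_div_assoc', div_le_iff₀ (by positivity)]
    nlinarith
  refine ⟨Real.pi * α ^ 2 / 2, by positivity, fun s h0 h1 δ hδ ↦ ?_⟩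
  let c' : PiLp 2 (fun _ : s ↦ X) := WithLp.toLp 2 (Pi.single ⟨0, h0⟩ c)
  let e' : PiLp 2 (fun _ : s ↦ X) := WithLp.toLp 2 (Pi.single ⟨1, h1⟩ e)
  let V : Submodule ℝ (PiLp 2 (fun _ : s ↦ X)) :=
    { carrier := {x | ∀ j : s, 0 < (j : ℤ) → x j = 0}
      add_mem' := fun hx hy j hj ↦ by simp [hx j hj, hy j hj]
      zero_mem' := fun j _ ↦ rfl
      smul_mem' := fun r x hx j hj ↦ by simp [hx j hj] }
  have hV (x) : x ∈ V ↔ ∀ j : s, 0 < (j : ℤ) → x j = 0 := Iff.rfl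
  have hVo {w} (hw : w ∈ Vᗮ) (j : s) (hj : (j : ℤ) ≤ 0) : w j = 0 := by
    have h2 : WithLp.toLp 2 (Pi.single j (w j)) ∈ V := by
      refine (hV _).2 fun i hi ↦ ?_
      have : i ≠ j := by rintro rfl; omega
      simp [Pi.single_eq_of_ne this]
    have h3 := (V.mem_orthogonal w).1 hw _ h2
    rw [PiLp.inner_apply, Finset.sum_eq_single j] at h3
    · simpa using h3
    · intro i _ hi
      simp [Pi.single_eq_of_ne hi]
    · simp
  have heV : e' ∈ Vᗮ := by
    refine (V.mem_orthogonal _).2 fun v hv ↦ ?_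
    rw [PiLp.inner_apply]
    refine Finset.sum_eq_zero fun j _ ↦ ?_
    by_cases hj : j = ⟨1, h1⟩
    · rw [hj, (hV v).1 hv _ one_pos, inner_zero_left]
    · simp [e', Pi.single_eq_of_ne hj]
  have he' : ‖e'‖ = 1 := by simp [e', he]
  let μ : ℝ := min δ₀ (a - Real.pi)
  have hμ : 0 < μ := lt_min hδ₀ (sub_pos.2 ha)
  let K : ℝ := C₂ / μ + 1
  have hK : 1 ≤ K := by simp only [K]; linarith [div_nonneg hC₂ hμ.le]
  have hμK : C₂ ≤ μ * K ^ 2 := by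
    have h2 : μ * K = C₂ + μ := by simp only [K]; field_simp
    nlinarith
  have hlink : ∀ v ∈ V, ∀ r : ℝ, 0 ≤ r → ‖c'‖ + 2 * K ≤ ‖v + r • e'‖ →
      loopAction J H s (v + r • e') ≤ 0 := by
    intro v hv r hr hvr
    have hle := loopAction_le hJ hJ2 hBJ hHc hHl h0 (v - c' + r • e')
    rw [show v - c' + r • e' + WithLp.toLp 2 (Pi.single ⟨0, h0⟩ c) = v + r • e' by
      simp only [c']; abel] at hle
    have hv' : v - c' ∈ V := by
      refine V.sub_mem hv ((hV _).2 fun j hj ↦ ?_)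
      have : j ≠ ⟨0, h0⟩ := by rintro rfl; simp at hj
      simp [c', Pi.single_eq_of_ne this]
    have hsum : ∑ j : s, (Real.pi * (j : ℤ) * ‖(v - c' + r • e') j‖ ^ 2
        - inner ℝ (B ((v - c' + r • e') j)) ((v - c' + r • e') j))
        ≤ ∑ j : s, (- (δ₀ * ‖(v - c') j‖ ^ 2)
          - if j = ⟨1, h1⟩ then (a - Real.pi) * r ^ 2 else 0) := by
      refine Finset.sum_le_sum fun j _ ↦ ?_
      by_cases hj : j = ⟨1, h1⟩
      · have h2 : (v - c') j = 0 := (hV _).1 hv' j (by simp [hj])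
        have h3 : (v - c' + r • e') j = r • e := by
          rw [PiLp.add_apply, h2, hj]; simp [e']
        rw [h3, h2, if_pos hj, map_smul, hBe, hj]
        simp only [norm_smul, he, real_inner_smul_left, real_inner_smul_right, norm_zero,
          real_inner_self_eq_norm_sq]
        simp
        apply le_of_eq
        ring
      · have h3 : (v - c' + r • e') j = (v - c') j := by
          rw [PiLp.add_apply]; simp [e', hj]
        rw [h3, if_neg hj, sub_zero]
        have h4 := hBδ ((v - c') j)
        have h5 : Real.pi * (j : ℤ) * ‖(v - c') j‖ ^ 2 ≤ 0 := by
          by_cases hj0 : 0 < (j : ℤ)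
          · rw [(hV _).1 hv' j hj0]; simp
          · have : ((j : ℤ) : ℝ) ≤ 0 := by exact_mod_cast not_lt.1 hj0
            have : Real.pi * (j : ℤ) ≤ 0 := mul_nonpos_of_nonneg_of_nonpos Real.pi_pos.le this
            exact mul_nonpos_of_nonpos_of_nonneg this (by positivity)
        linarith
    rw [Finset.sum_sub_distrib (f := fun j ↦ -(δ₀ * ‖(v - c') j‖ ^ 2)), Finset.sum_neg_distrib,
      ← Finset.mul_sum, ← PiLp.norm_sq_eq_of_L2,
      Finset.sum_ite_eq' Finset.univ, if_pos (Finset.mem_univ _)] at hsum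
    have hn : 2 * K ≤ ‖v - c'‖ + r := by
      have h2 : ‖v + r • e'‖ ≤ ‖v - c'‖ + ‖c'‖ + r := by
        calc ‖v + r • e'‖ = ‖(v - c') + c' + r • e'‖ := by congr 1; abel
          _ ≤ ‖v - c'‖ + ‖c'‖ + ‖r • e'‖ := norm_add₃_le
          _ = _ := by rw [norm_smul, he', mul_one, Real.norm_of_nonneg hr]
      linarith
    have hμ1 : μ ≤ δ₀ := min_le_left _ _
    have hμ2 : μ ≤ a - Real.pi := min_le_right _ _
    have h5 : K ^ 2 ≤ ‖v - c'‖ ^ 2 + r ^ 2 := by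
      nlinarith [sq_nonneg (‖v - c'‖ - r)]
    have h6 : μ * ‖v - c'‖ ^ 2 ≤ δ₀ * ‖v - c'‖ ^ 2 := by gcongr
    have h7 : μ * r ^ 2 ≤ (a - Real.pi) * r ^ 2 := by gcongr
    have h8 := mul_le_mul_of_nonneg_left h5 hμ.le
    linarith
  exact exists_gradient_lt_of_linking (contDiff_loopAction J hg hgc s) V heV he' hα
    (by positivity) (fun v hv ↦ loopAction_nonpos J hH0 ((hV v).1 hv)) hlink
    (fun w hw hwα ↦ le_loopAction hJ hJ2 hHc hC₃ hρ hHu (by linarith) hmα hα.le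
      (fun j hj ↦ hVo hw j hj) hwα) hδ

/-- Almost critical points of the action functional are bounded in the Sobolev norm `H¹`. -/
theorem sum_sq_mul_norm_sq_le [FiniteDimensional ℝ X] {J : X →L[ℝ] X}
    (hJ : ∀ x y, inner ℝ (J x) y = -inner ℝ x (J y)) (hJ2 : ∀ x, J (J x) = -x) {B : X →L[ℝ] X}
    (hBJ : ∀ x, B (J x) = J (B x)) {ν : ℝ} (hν : 0 < ν)
    (hBν : ∀ (j : ℤ) x, ν * (1 + |(j : ℝ)|) * ‖x‖ ≤ ‖(Real.pi * j) • x - B x‖)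
    {H : X → ℝ} {g : X → X} (hg : ∀ x, HasGradientAt H (g x) x) (hgc : Continuous g) {C₁ : ℝ}
    (hgB : ∀ x, ‖g x - (2 : ℝ) • B x‖ ≤ C₁) {s : Finset ℤ} {x : PiLp 2 (fun _ : s ↦ X)} {δ : ℝ}
    (hx : ‖gradient (loopAction J H s) x‖ ≤ δ) :
    ∑ j : s, (1 + |((j : ℤ) : ℝ)|) ^ 2 * ‖x j‖ ^ 2 ≤ (δ ^ 2 + C₁ ^ 2) / (2 * ν ^ 2) := by
  have hl := continuous_trigLoop J (s := s)
  let b : PiLp 2 (fun _ : s ↦ X) := WithLp.toLp 2 fun j ↦ B (x j)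
  let y : PiLp 2 (fun _ : s ↦ X) := WithLp.toLp 2 fun j ↦ (Real.pi * (j : ℤ)) • x j - B (x j)
  have h1 := fderiv_loopAction J hg hgc s x y
  have h2 : fderiv ℝ (loopAction J H s) x y ≤ δ * ‖y‖ := by
    have : fderiv ℝ (loopAction J H s) x y = inner ℝ (gradient (loopAction J H s) x) y := by
      rw [gradient, InnerProductSpace.toDual_symm_apply]
    rw [this]
    exact (real_inner_le_norm _ _).trans (by gcongr)
  have h3 := integral_inner_trigLoop hJ hJ2 b y
  have h4 := integral_inner_trigLoop hJ hJ2 y y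
  have h5 : ∫ t, inner ℝ (g (trigLoop J t x)) (trigLoop J t y) ∂haarAddCircle
      ≤ ∫ t, (2 * inner ℝ (trigLoop J t b) (trigLoop J t y) + (C₁ ^ 2 / 2
        + 1 / 2 * inner ℝ (trigLoop J t y) (trigLoop J t y))) ∂haarAddCircle := by
    refine integral_mono (Continuous.integrable_haar (by fun_prop))
      (Continuous.integrable_haar (by fun_prop)) fun t ↦ ?_
    have h6 := real_inner_le_norm (g (trigLoop J t x) - (2 : ℝ) • B (trigLoop J t x)) (trigLoop J t y)
    have h7 := mul_le_mul_of_nonneg_right (hgB (trigLoop J t x)) (norm_nonneg (trigLoop J t y))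
    rw [map_trigLoop hBJ, inner_sub_left, real_inner_smul_left] at h6
    rw [map_trigLoop hBJ] at h7
    simp only [real_inner_self_eq_norm_sq, b]
    nlinarith [sq_nonneg (C₁ - ‖trigLoop J t y‖)]
  have hi (z w : PiLp 2 (fun _ : s ↦ X)) (r : ℝ) : Integrable (fun t ↦
      r * inner ℝ (trigLoop J t z) (trigLoop J t w)) haarAddCircle :=
    Continuous.integrable_haar (by fun_prop)
  have hi' : Integrable (fun t ↦ C₁ ^ 2 / 2
      + 1 / 2 * inner ℝ (trigLoop J t y) (trigLoop J t y)) haarAddCircle :=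
    Continuous.integrable_haar (by fun_prop)
  rw [integral_add (hi _ _ _) hi', integral_add (integrable_const _) (hi _ _ _), integral_const_mul, integral_const_mul,
    h3, h4, real_inner_self_eq_norm_sq] at h5
  simp only [integral_const, probReal_univ, smul_eq_mul, one_mul] at h5
  have h6 : ∑ j : s, 2 * Real.pi * (j : ℤ) * inner ℝ (x j) (y j)
      = 2 * inner ℝ b y + 2 * ‖y‖ ^ 2 := by
    rw [← real_inner_self_eq_norm_sq, ← mul_add, ← inner_add_left, PiLp.inner_apply,
      Finset.mul_sum]
    refine Finset.sum_congr rfl fun j _ ↦ ?_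
    have : (b + y) j = (Real.pi * (j : ℤ)) • x j := by simp [b, y]
    rw [this, real_inner_smul_left]
    ring
  have h7 : ‖y‖ ^ 2 ≤ (δ ^ 2 + C₁ ^ 2) / 2 := by nlinarith [sq_nonneg (δ - ‖y‖)]
  rw [le_div_iff₀ (by positivity)]
  have h8 : ∑ j : s, (1 + |((j : ℤ) : ℝ)|) ^ 2 * ‖x j‖ ^ 2 * ν ^ 2 ≤ ‖y‖ ^ 2 := by
    rw [PiLp.norm_sq_eq_of_L2]
    refine Finset.sum_le_sum fun j _ ↦ ?_
    have h9 : ‖y j‖ = ‖(Real.pi * (j : ℤ)) • x j - B (x j)‖ := rfl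
    calc _ = (ν * (1 + |((j : ℤ) : ℝ)|) * ‖x j‖) ^ 2 := by ring
      _ ≤ _ := by rw [h9]; gcongr; exact hBν j (x j)
  rw [← Finset.sum_mul] at h8
  linarith

end

end

section

open Set Metric Module MeasureTheory AddCircle Filter Topology
open scoped ComplexConjugate

theorem ContinuousMap.eq_const_of_fourierCoeff_eq_zero {f : C(UnitAddCircle, ℂ)}
    (hf : ∀ n ≠ 0, fourierCoeff f n = 0) (t : UnitAddCircle) : f t = fourierCoeff f 0 := by
  have hs : Summable (fourierCoeff f) :=
    summable_of_ne_finset_zero (s := {0}) fun n hn ↦ hf n (by simpa using hn)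
  have h := has_pointwise_sum_fourier_series_of_summable hs t
  have h1 := hasSum_single (f := fun i ↦ fourierCoeff f i • (fourier i t : ℂ)) 0
    fun n hn ↦ by rw [hf n hn, zero_smul]
  rw [fourier_zero, smul_eq_mul, mul_one] at h1
  exact h.unique h1

theorem fourierCoeff_zero (f : UnitAddCircle → ℂ) :
    fourierCoeff f 0 = ∫ x in (0 : ℝ)..1, f x := by
  rw [fourierCoeff_eq_intervalIntegral _ _ 0]; simp

/-- A continuous function on the circle whose Fourier coefficients are those of an antiderivative of
a continuous function `w` is differentiable with derivative `w`. -/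
theorem ContinuousMap.hasDerivAt_of_fourierCoeff {f w : C(UnitAddCircle, ℂ)}
    (h : ∀ n : ℤ, 2 * Real.pi * Complex.I * n * fourierCoeff f n = fourierCoeff w n) (t : ℝ) :
    HasDerivAt (fun t : ℝ ↦ f t) (w t) t := by
  have hwc : Continuous fun t : ℝ ↦ w t := by fun_prop
  let F : ℝ → ℂ := fun t ↦ ∫ x in (0 : ℝ)..t, w x
  have hF (t : ℝ) : HasDerivAt F (w t) t := intervalIntegral.integral_hasDerivAt_right
    (hwc.intervalIntegrable _ _) (hwc.stronglyMeasurableAtFilter _ _) hwc.continuousAt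
  have hF1 : F 1 = 0 := by
    have := h 0
    rw [fourierCoeff_zero w] at this
    simpa using this.symm
  have hper : Function.Periodic F 1 := fun t ↦ by
    have h1 : Function.Periodic (fun t : ℝ ↦ w t) 1 := fun t ↦ by simp
    have h2 := h1.intervalIntegral_add_eq t 0
    rw [zero_add] at h2
    simp only [F]
    rw [← intervalIntegral.integral_add_adjacent_intervals (b := t) (hwc.intervalIntegrable _ _)
      (hwc.intervalIntegrable _ _), h2]
    simp only [F] at hF1
    rw [hF1, add_zero]
  have hFc : Continuous F := continuous_iff_continuousAt.2 fun t ↦ (hF t).continuousAt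
  let G : C(UnitAddCircle, ℂ) := ⟨hper.lift, continuous_coinduced_dom.2 hFc⟩
  have hG (t : ℝ) : G t = F t := rfl
  have hcoef (n : ℤ) (hn : n ≠ 0) : fourierCoeff G n = fourierCoeff f n := by
    have h1 := fourierCoeffOn_of_hasDerivAt zero_lt_one hn (fun x _ ↦ hF x)
      (hwc.intervalIntegrable _ _)
    have h2 (u : C(UnitAddCircle, ℂ)) : fourierCoeff u n
        = fourierCoeffOn zero_lt_one (fun t : ℝ ↦ u t) n := by
      rw [fourierCoeff_eq_intervalIntegral _ _ 0, fourierCoeffOn_eq_integral]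
      simp only [sub_zero, zero_add]
      congr 1
      refine intervalIntegral.integral_congr fun x _ ↦ ?_
      simp only [fourier_coe_apply, sub_zero]
    have h3 : F 0 = 0 := by simp [F]
    rw [hF1, h3, ← h2 w, ← h n] at h1
    rw [(h2 G).trans h1]
    have : (n : ℂ) ≠ 0 := by exact_mod_cast hn
    have := Real.pi_ne_zero
    have := Complex.I_ne_zero
    push_cast
    field_simp
    ring
  have hd : ∀ t, (f - G) t = fourierCoeff (f - G) 0 :=
    ContinuousMap.eq_const_of_fourierCoeff_eq_zero fun n hn ↦ by
      have h1 : ⇑(f - G) = ⇑f + (-1 : ℂ) • ⇑G := by ext; simp [sub_eq_add_neg]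
      rw [h1, fourierCoeff.add (map_continuous f).integrable_haar
        ((map_continuous G).const_smul (-1 : ℂ)).integrable_haar]
      have h2 := fourierCoeff.const_smul G (-1 : ℂ) n
      simp only [Pi.add_apply]
      rw [show fourierCoeff ((-1 : ℂ) • ⇑G) n = _ from h2, hcoef n hn]
      simp
  have hfF : (fun t : ℝ ↦ f t) = fun t ↦ F t + fourierCoeff (f - G) 0 := by
    ext t
    have := hd t
    rw [ContinuousMap.sub_apply, hG] at this
    rw [← this]; ring
  rw [hfF]
  exact (hF t).add_const _

section
variable {X : Type*} [NormedAddCommGroup X] [InnerProductSpace ℝ X]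

theorem hasDerivAt_of_inner [FiniteDimensional ℝ X] {f : ℝ → X} {f' : X} {t : ℝ}
    (h : ∀ v, HasDerivAt (fun t ↦ inner ℝ (f t) v) (inner ℝ f' v) t) : HasDerivAt f f' t := by
  let b := stdOrthonormalBasis ℝ X
  have h1 : HasDerivAt (fun t ↦ ∑ i, inner ℝ (b i) (f t) • b i) (∑ i, inner ℝ (b i) f' • b i) t := by
    refine HasDerivAt.fun_sum fun i _ ↦ HasDerivAt.smul_const ?_ _
    simpa only [real_inner_comm] using h (b i)
  simpa only [b.sum_repr'] using h1

/-- Weak solutions of `x' = J w` are strong solutions. -/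
theorem hasDerivAt_of_integral_cact [FiniteDimensional ℝ X] {J : X →L[ℝ] X}
    (hJ : ∀ x y, inner ℝ (J x) y = -inner ℝ x (J y)) (hJ2 : ∀ x, J (J x) = -x)
    {x w : C(UnitAddCircle, X)}
    (h : ∀ (n : ℤ) (v : X), 2 * Real.pi * n * ∫ t, inner ℝ (x t) (cact J (fourier n t) v) ∂haarAddCircle
      = ∫ t, inner ℝ (w t) (cact J (fourier n t) v) ∂haarAddCircle) (t : ℝ) :
    HasDerivAt (fun t : ℝ ↦ x t) (J (w t)) t := by
  refine hasDerivAt_of_inner fun v ↦ ?_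
  let γ (u : C(UnitAddCircle, X)) : C(UnitAddCircle, ℂ) :=
    ⟨fun t ↦ (inner ℝ (u t) v : ℝ) + (inner ℝ (u t) (J v) : ℝ) * Complex.I, by fun_prop⟩
  have hγ (u : C(UnitAddCircle, X)) (n : ℤ) : fourierCoeff (γ u) n
      = (∫ t, inner ℝ (u t) (cact J (fourier n t) v) ∂haarAddCircle : ℝ)
        + (∫ t, inner ℝ (u t) (cact J (fourier n t) (J v)) ∂haarAddCircle : ℝ) * Complex.I := by
    have hc (v) : Continuous fun t : UnitAddCircle ↦ cact J (fourier n t) v := by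
      unfold cact; fun_prop
    have hc' (v) : Continuous fun t : UnitAddCircle ↦ (inner ℝ (u t) (cact J (fourier n t) v) : ℂ) := by
      have := hc v
      fun_prop
    rw [← integral_complex_ofReal, ← integral_complex_ofReal, ← integral_mul_const, ← integral_add
      (hc' _).integrable_haar ((hc' _).integrable_haar.mul_const _)]
    refine integral_congr_ae (.of_forall fun t ↦ ?_)
    simp only [γ, fourier_neg, ContinuousMap.coe_mk, smul_eq_mul, cact, hJ2, inner_add_right,
      real_inner_smul_right, inner_neg_right]
    apply Complex.ext <;> simp
  have hd : HasDerivAt (fun t : ℝ ↦ γ x t) ((Complex.I • γ w) t) t := by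
    refine ContinuousMap.hasDerivAt_of_fourierCoeff (fun n ↦ ?_) t
    have h1 : fourierCoeff (Complex.I • γ w) n = Complex.I * fourierCoeff (γ w) n := by
      have := fourierCoeff.const_smul (γ w) Complex.I n
      simpa using this
    rw [h1, hγ, hγ, ← h, ← h]
    push_cast
    ring
  have := (Complex.reCLM.hasFDerivAt.comp_hasDerivAt t hd)
  convert! this using 1
  · ext t; simp [γ]
  · simp [γ, hJ]

end

end

section

open Set Metric Module MeasureTheory AddCircle Filter Topology BoundedContinuousFunction
open scoped ComplexConjugate

theorem summable_inv_one_add_abs_sq : Summable fun j : ℤ ↦ 1 / (1 + |(j : ℝ)|) ^ 2 := by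
  refine (Real.summable_one_div_int_pow.2 one_lt_two).of_norm_bounded_eventually ?_
  filter_upwards [(Set.finite_singleton (0 : ℤ)).compl_mem_cofinite] with j hj
  have hj0 : (j : ℝ) ≠ 0 := by exact_mod_cast hj
  rw [Real.norm_of_nonneg (by positivity)]
  refine one_div_le_one_div_of_le (by positivity) ?_
  rw [← sq_abs (j : ℝ)]
  gcongr
  linarith

theorem sq_sum_mul_le_of_sobolev {s : Finset ℤ} {a u : ℤ → ℝ} {K C : ℝ} (ha : ∀ j, |a j| ≤ K)
    (hu : ∑ j : s, (1 + |((j : ℤ) : ℝ)|) ^ 2 * u j ^ 2 ≤ C) :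
    (∑ j : s, a j * u j) ^ 2 ≤ (∑' j : ℤ, a j ^ 2 * (1 / (1 + |(j : ℝ)|) ^ 2)) * C := by
  have hs : Summable fun j : ℤ ↦ a j ^ 2 * (1 / (1 + |(j : ℝ)|) ^ 2) := by
    refine .of_nonneg_of_le (fun j ↦ by positivity) (fun j ↦ ?_)
      (summable_inv_one_add_abs_sq.mul_left (K ^ 2))
    refine mul_le_mul_of_nonneg_right ?_ (by positivity)
    rw [← sq_abs]
    have := ha j
    gcongr
  have h1 := Finset.sum_mul_sq_le_sq_mul_sq Finset.univ (fun j : s ↦ a j / (1 + |((j : ℤ) : ℝ)|))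
    (fun j : s ↦ (1 + |((j : ℤ) : ℝ)|) * u j)
  have h2 : ∑ j : s, (a j / (1 + |((j : ℤ) : ℝ)|)) * ((1 + |((j : ℤ) : ℝ)|) * u j)
      = ∑ j : s, a j * u j := by
    refine Finset.sum_congr rfl fun j _ ↦ ?_
    have : 1 + |((j : ℤ) : ℝ)| ≠ 0 := by positivity
    field_simp
  rw [h2] at h1
  refine h1.trans (mul_le_mul ?_ ?_ (Finset.sum_nonneg fun j _ ↦ sq_nonneg _)
    (tsum_nonneg fun j ↦ by positivity))
  · refine le_trans (le_of_eq ?_) (hs.sum_le_tsum s fun j _ ↦ by positivity)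
    rw [← Finset.sum_coe_sort s]
    exact Finset.sum_congr rfl fun j _ ↦ by rw [div_pow, mul_one_div]
  · simpa only [mul_pow] using hu

theorem tendsto_integral_comp_unitAddCircle {X : Type*} [NormedAddCommGroup X] [ProperSpace X]
    {F : UnitAddCircle → X → ℝ} (hF : Continuous F.uncurry) {x : ℕ → C(UnitAddCircle, X)}
    {y : C(UnitAddCircle, X)} {M : ℝ} (hM : ∀ k t, ‖x k t‖ ≤ M)
    (hxy : ∀ t, Tendsto (x · t) atTop (𝓝 (y t))) :
    Tendsto (fun k ↦ ∫ t, F t (x k t) ∂haarAddCircle) atTop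
      (𝓝 (∫ t, F t (y t) ∂haarAddCircle)) := by
  obtain ⟨K, hK⟩ := ((isCompact_univ (X := UnitAddCircle)).prod
    (isCompact_closedBall (0 : X) M)).bddAbove_image hF.norm.continuousOn
  refine tendsto_integral_of_dominated_convergence (fun _ ↦ K) (fun k ↦ ?_) (integrable_const _)
    (fun k ↦ .of_forall fun t ↦ ?_) (.of_forall fun t ↦ ?_)
  · exact Continuous.aestronglyMeasurable (hF.comp (by fun_prop : Continuous fun t ↦ (t, x k t)))
  · exact hK ⟨(t, x k t), ⟨mem_univ _, by simpa using hM k t⟩, rfl⟩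
  · exact (hF.tendsto (t, y t)).comp (tendsto_const_nhds.prodMk_nhds (hxy t))

section
variable {X : Type*} [NormedAddCommGroup X] [InnerProductSpace ℝ X]

/-- Trigonometric loops bounded in the Sobolev norm `H¹` form a relatively compact set in the
uniform norm. -/
theorem exists_subseq_tendsto_of_sobolev [FiniteDimensional ℝ X] {J : X →L[ℝ] X}
    (hJ : ∀ x y, inner ℝ (J x) y = -inner ℝ x (J y)) (hJ2 : ∀ x, J (J x) = -x) {C : ℝ}
    {s : ℕ → Finset ℤ} {x : ∀ k, PiLp 2 (fun _ : s k ↦ X)}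
    (hx : ∀ k, ∑ j : s k, (1 + |((j : ℤ) : ℝ)|) ^ 2 * ‖x k j‖ ^ 2 ≤ C) :
    ∃ (y : C(UnitAddCircle, X)) (φ : ℕ → ℕ) (M : ℝ), StrictMono φ ∧
      (∀ k t, ‖trigLoop J t (x k)‖ ≤ M) ∧
      ∀ t, Tendsto (fun k ↦ trigLoop J t (x (φ k))) atTop (𝓝 (y t)) := by
  have := FiniteDimensional.proper_real X
  have hsob (a : ℤ → ℝ) {K : ℝ} (ha : ∀ j, |a j| ≤ K) (k : ℕ) :
      (∑ j : s k, a j * ‖x k j‖) ^ 2 ≤ (∑' j : ℤ, a j ^ 2 * (1 / (1 + |(j : ℝ)|) ^ 2)) * C := by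
    have := sq_sum_mul_le_of_sobolev (s := s k) (u := fun j ↦ if h : j ∈ s k then ‖x k ⟨j, h⟩‖ else 0)
      (C := C) ha (by simpa using hx k)
    simpa using this
  let M : ℝ := √((∑' j : ℤ, (1 : ℝ) ^ 2 * (1 / (1 + |(j : ℝ)|) ^ 2)) * C)
  have hM (k t) : ‖trigLoop J t (x k)‖ ≤ M := by
    refine (norm_trigLoop_le hJ hJ2 t _).trans (Real.le_sqrt_of_sq_le ?_)
    simpa using hsob (fun _ ↦ 1) (K := 1) (by simp) k
  let b (t₀ t : UnitAddCircle) : ℝ :=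
    √((∑' j : ℤ, ‖(fourier j t₀ : ℂ) - fourier j t‖ ^ 2 * (1 / (1 + |(j : ℝ)|) ^ 2)) * C)
  have hf2 (j : ℤ) (t₀ t : UnitAddCircle) : ‖(fourier j t₀ : ℂ) - fourier j t‖ ≤ 2 := by
    refine (norm_sub_le _ _).trans (le_of_eq ?_)
    rw [fourier_apply, fourier_apply, Circle.norm_coe, Circle.norm_coe]
    norm_num
  have hb (t₀) : Continuous (b t₀) := by
    refine Real.continuous_sqrt.comp (Continuous.mul ?_ continuous_const)
    refine continuous_tsum (fun j ↦ by fun_prop) (summable_inv_one_add_abs_sq.mul_left (2 ^ 2))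
      fun j t ↦ ?_
    rw [Real.norm_of_nonneg (by positivity)]
    have := hf2 j t₀ t
    gcongr
  have hbd (k t₀ t) : dist (trigLoop J t₀ (x k)) (trigLoop J t (x k)) ≤ b t₀ t := by
    rw [dist_eq_norm, trigLoop_apply, trigLoop_apply, ← Finset.sum_sub_distrib]
    refine (norm_sum_le _ _).trans (Real.le_sqrt_of_sq_le ?_)
    simp_rw [← cact_sub_left, norm_cact hJ hJ2]
    exact hsob (fun j ↦ ‖(fourier j t₀ : ℂ) - fourier j t‖) (K := 2) (by simpa using fun j ↦ hf2 j t₀ t) k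
  let z (k : ℕ) : UnitAddCircle →ᵇ X := mkOfCompact
    ⟨fun t ↦ trigLoop J t (x k), by have := continuous_trigLoop J (s := s k); fun_prop⟩
  have hz (k t) : z k t = trigLoop J t (x k) := rfl
  have hcpt := arzela_ascoli (closedBall (0 : X) M) (isCompact_closedBall _ _) (range z) (by
      rintro f t ⟨k, rfl⟩
      simpa [hz] using hM k t) fun t₀ ↦ by
      refine equicontinuousAt_of_continuity_modulus (b t₀) ?_ _ (.of_forall fun t ⟨f, hf⟩ ↦ ?_)
      · convert! (hb t₀).tendsto t₀ using 2
        simp [b]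
      · obtain ⟨k, rfl⟩ := hf
        exact hbd k t₀ t
  obtain ⟨y, -, φ, hφ, hy⟩ := hcpt.tendsto_subseq (x := z) fun k ↦ subset_closure ⟨k, rfl⟩
  refine ⟨y, φ, M, hφ, hM, fun t ↦ ?_⟩
  exact ((continuous_eval_const (F := UnitAddCircle →ᵇ X) t).tendsto y).comp hy

/-- Existence of a `1`-periodic orbit of positive action for an asymptotically quadratic,
non-resonant Hamiltonian. -/
theorem exists_periodic_orbit [FiniteDimensional ℝ X] {J : X →L[ℝ] X}
    (hJ : ∀ x y, inner ℝ (J x) y = -inner ℝ x (J y)) (hJ2 : ∀ x, J (J x) = -x) {B : X →L[ℝ] X}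
    (hBJ : ∀ x, B (J x) = J (B x)) {e : X} (he : ‖e‖ = 1) {a : ℝ} (hBe : B e = a • e)
    (ha : Real.pi < a) {δ₀ : ℝ} (hδ₀ : 0 < δ₀) (hBδ : ∀ x, δ₀ * ‖x‖ ^ 2 ≤ inner ℝ (B x) x)
    {ν : ℝ} (hν : 0 < ν)
    (hBν : ∀ (j : ℤ) x, ν * (1 + |(j : ℝ)|) * ‖x‖ ≤ ‖(Real.pi * j) • x - B x‖)
    {H : X → ℝ} {g : X → X} (hg : ∀ x, HasGradientAt H (g x) x) (hgc : Continuous g) {C₁ : ℝ}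
    (hgB : ∀ x, ‖g x - (2 : ℝ) • B x‖ ≤ C₁)
    (hH0 : ∀ x, 0 ≤ H x) {ρ : ℝ} (hρ0 : 0 < ρ) (hρ : ∀ x, ‖x‖ < ρ → H x = 0) {c : X} {C₂ : ℝ}
    (hC₂ : 0 ≤ C₂) (hHl : ∀ x, inner ℝ (B (x - c)) (x - c) - C₂ ≤ H x) {C₃ : ℝ} (hC₃ : 0 ≤ C₃)
    (hHu : ∀ x, H x ≤ C₃ * ‖x‖ ^ 2) :
    ∃ x : C(UnitAddCircle, X), (∀ t : ℝ, HasDerivAt (fun t : ℝ ↦ x t) (J (g (x t))) t) ∧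
      (∀ v, ∫ t, inner ℝ (g (x t)) v ∂haarAddCircle = 0) ∧
      0 < ∫ t, (1 / 2 * inner ℝ (g (x t)) (x t) - H (x t)) ∂haarAddCircle := by
  have := FiniteDimensional.proper_real X
  have hHc : Continuous H := continuous_iff_continuousAt.2 fun x ↦ (hg x).hasFDerivAt.continuousAt
  obtain ⟨β, hβ, hcrit⟩ := exists_gradient_loopAction_lt hJ hJ2 hBJ he hBe ha hδ₀ hBδ hg hgc hH0 hρ0
    hρ hC₂ hHl hC₃ hHu
  let s (k : ℕ) : Finset ℤ := Finset.Icc (-((k : ℤ) + 1)) (k + 1)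
  have hd (k : ℕ) : (0 : ℝ) < 1 / (k + 1) := by positivity
  choose x hxβ hxδ using fun k : ℕ ↦ hcrit (s k) (by simp [s]; omega) (by simp [s]; omega) _ (hd k)
  have hd1 (k : ℕ) : (1 : ℝ) / (k + 1) ≤ 1 := by
    rw [div_le_one (by positivity)]; linarith [k.cast_nonneg (α := ℝ)]
  let C : ℝ := (1 ^ 2 + C₁ ^ 2) / (2 * ν ^ 2)
  have hsob (k) := sum_sq_mul_norm_sq_le hJ hJ2 hBJ hν hBν hg hgc hgB ((hxδ k).le.trans (hd1 k))
  obtain ⟨y, φ, M, hφ, hM, hy⟩ := exists_subseq_tendsto_of_sobolev hJ hJ2 hsob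
  let z (k : ℕ) : C(UnitAddCircle, X) := ⟨fun t ↦ trigLoop J t (x (φ k)), by
    have := continuous_trigLoop J (s := s (φ k)); fun_prop⟩
  have hz (k t) : z k t = trigLoop J t (x (φ k)) := rfl
  have hlim {F : UnitAddCircle → X → ℝ} (hF : Continuous F.uncurry) :
      Tendsto (fun k ↦ ∫ t, F t (z k t) ∂haarAddCircle) atTop
        (𝓝 (∫ t, F t (y t) ∂haarAddCircle)) :=
    tendsto_integral_comp_unitAddCircle hF (fun k t ↦ hM (φ k) t) hy
  have hdlim : Tendsto (fun k ↦ (1 : ℝ) / (φ k + 1)) atTop (𝓝 0) :=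
    tendsto_one_div_add_atTop_nhds_zero_nat.comp hφ.tendsto_atTop
  have hfd (k) (w) : |fderiv ℝ (loopAction J H (s k)) (x k) w| ≤ 1 / (k + 1) * ‖w‖ := by
    have : fderiv ℝ (loopAction J H (s k)) (x k) w
        = inner ℝ (gradient (loopAction J H (s k)) (x k)) w := by
      rw [gradient, InnerProductSpace.toDual_symm_apply]
    rw [this]
    refine (abs_real_inner_le_norm _ _).trans ?_
    have := (hxδ k).le
    gcongr
  have hweak (n : ℤ) (v : X) :
      2 * Real.pi * n * ∫ t, inner ℝ (y t) (cact J (fourier n t) v) ∂haarAddCircle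
        = ∫ t, inner ℝ (g (y t)) (cact J (fourier n t) v) ∂haarAddCircle := by
    have hc : Continuous fun t : UnitAddCircle ↦ cact J (fourier n t) v := by
      unfold cact; fun_prop
    have h1 := (hlim (F := fun t u ↦ inner ℝ u (cact J (fourier n t) v))
      (continuous_snd.inner (hc.comp continuous_fst))).const_mul (2 * Real.pi * n)
    have h2 := hlim (F := fun t u ↦ inner ℝ (g u) (cact J (fourier n t) v))
      ((hgc.comp continuous_snd).inner (hc.comp continuous_fst))
    refine sub_eq_zero.1 (tendsto_nhds_unique (h1.sub h2) ?_)
    refine squeeze_zero_norm' ?_ (by simpa using hdlim.mul_const ‖v‖)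
    filter_upwards [hφ.tendsto_atTop.eventually_ge_atTop n.natAbs] with k hk
    have hn : n ∈ s (φ k) := by simp only [s, Finset.mem_Icc]; omega
    have h3 := hfd (φ k) (WithLp.toLp 2 (Pi.single ⟨n, hn⟩ v))
    have h4 := integral_inner_trigLoop hJ hJ2 (x (φ k)) (WithLp.toLp 2 (Pi.single ⟨n, hn⟩ v))
    rw [fderiv_loopAction J hg hgc] at h3
    simp only [trigLoop_single] at h3 h4
    rw [PiLp.inner_apply] at h4
    simp_rw [hz]
    rw [h4, Finset.mul_sum]
    have h5 : ‖(WithLp.toLp 2 (Pi.single ⟨n, hn⟩ v) : PiLp 2 (fun _ : s (φ k) ↦ X))‖ = ‖v‖ :=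
      PiLp.norm_single 2 (fun _ : s (φ k) ↦ X) ⟨n, hn⟩ v
    rw [h5] at h3
    convert! h3 using 2
    · congr 1
      refine Finset.sum_congr rfl fun j _ ↦ ?_
      by_cases hj : j = ⟨n, hn⟩
      · simp [hj]
      · simp [Pi.single_eq_of_ne hj]
    · simp
  refine ⟨y, fun t ↦ ?_, fun v ↦ ?_, ?_⟩
  · exact hasDerivAt_of_integral_cact hJ hJ2 (x := y) (w := ⟨fun t ↦ g (y t), by fun_prop⟩) hweak t
  · have := hweak 0 v
    simp only [Int.cast_zero, mul_zero, zero_mul, fourier_zero, cact, Complex.one_re, Complex.one_im,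
      one_smul, zero_smul, add_zero] at this
    exact this.symm
  · have h1 := hlim (F := fun _ u ↦ 1 / 2 * inner ℝ (g u) u - H u) (by
      unfold Function.uncurry; fun_prop)
    have h2 : Tendsto (fun k ↦ β - 1 / 2 * (1 / (φ k + 1) * √C)) atTop (𝓝 (β - 1 / 2 * (0 * √C))) :=
      ((hdlim.mul_const _).const_mul _).const_sub _
    have h3 : β - 1 / 2 * (0 * √C) ≤ _ := le_of_tendsto_of_tendsto' h2 h1 fun k ↦ by
      have h4 := hfd (φ k) (x (φ k))
      have h5 := hxβ (φ k)
      have h6 : ‖x (φ k)‖ ≤ √C := by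
        refine Real.le_sqrt_of_sq_le (le_trans ?_ (hsob (φ k)))
        rw [PiLp.norm_sq_eq_of_L2]
        refine Finset.sum_le_sum fun j _ ↦ le_mul_of_one_le_left (by positivity) ?_
        exact one_le_pow₀ (by linarith [abs_nonneg ((j : ℤ) : ℝ)])
      have h7 : 1 / ((φ k : ℝ) + 1) * ‖x (φ k)‖ ≤ 1 / (φ k + 1) * √C := by gcongr
      have hl := continuous_trigLoop J (s := s (φ k))
      rw [fderiv_loopAction J hg hgc] at h4
      unfold loopAction at h5
      have h8 : ∑ j : s (φ k), 2 * Real.pi * (j : ℤ) * inner ℝ (x (φ k) j) (x (φ k) j)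
          = 2 * ∑ j : s (φ k), Real.pi * (j : ℤ) * ‖x (φ k) j‖ ^ 2 := by
        rw [Finset.mul_sum]
        refine Finset.sum_congr rfl fun j _ ↦ ?_
        rw [real_inner_self_eq_norm_sq]; ring
      rw [h8] at h4
      simp_rw [hz]
      rw [integral_sub (Continuous.integrable_haar (by fun_prop))
        (Continuous.integrable_haar (by fun_prop)), integral_const_mul]
      linarith [le_abs_self (2 * ∑ j : s (φ k), Real.pi * (j : ℤ) * ‖x (φ k) j‖ ^ 2 - ∫ t,
        inner ℝ (g (trigLoop J t (x (φ k)))) (trigLoop J t (x (φ k))) ∂haarAddCircle)]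
    simp only [zero_mul, mul_zero, sub_zero] at h3
    exact hβ.trans_le h3

end

end

section

open Set Metric Module MeasureTheory AddCircle Filter Topology

theorem hasDerivAt_max_zero_sq (s : ℝ) :
    HasDerivAt (fun s : ℝ ↦ max s 0 ^ 2) (2 * max s 0) s := by
  rcases lt_trichotomy s 0 with hs | rfl | hs
  · rw [max_eq_right hs.le, mul_zero]
    refine (hasDerivAt_const s (0 : ℝ)).congr_of_eventuallyEq ?_
    filter_upwards [Iio_mem_nhds hs] with t ht
    simp [max_eq_right (mem_Iio.1 ht).le]
  · rw [max_self, mul_zero]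
    refine HasDerivAt.of_isLittleO ?_
    refine Asymptotics.IsBigO.trans_isLittleO (g := fun t : ℝ ↦ t ^ 2) ?_ ?_
    · refine Asymptotics.IsBigO.of_bound 1 (Eventually.of_forall fun t ↦ ?_)
      rcases le_total t 0 with ht | ht <;> simp [ht, sq_nonneg]
    · simpa using Asymptotics.isLittleO_pow_id (𝕜 := ℝ) one_lt_two
  · rw [max_eq_left hs.le]
    have := hasDerivAt_pow 2 s
    refine (by simpa using this : HasDerivAt (fun s : ℝ ↦ s ^ 2) (2 * s) s).congr_of_eventuallyEq ?_
    filter_upwards [Ioi_mem_nhds hs] with t ht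
    simp [max_eq_left (mem_Ioi.1 ht).le]

/-- A `C¹` convex function that vanishes for `s ≤ 0` and equals `s - c` for `2 * c ≤ s`. -/
noncomputable def softPos (c s : ℝ) : ℝ := (max s 0 ^ 2 - max (s - 2 * c) 0 ^ 2) / (4 * c)

/-- The derivative of `softPos`. -/
noncomputable def softStep (c s : ℝ) : ℝ := (max s 0 - max (s - 2 * c) 0) / (2 * c)

section softPos

variable {c s : ℝ}

theorem hasDerivAt_softPos : HasDerivAt (softPos c) (softStep c s) s := by
  have h1 : HasDerivAt (fun s : ℝ ↦ max (s - 2 * c) 0 ^ 2) (2 * max (s - 2 * c) 0) s := by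
    exact (hasDerivAt_max_zero_sq (s - 2 * c)).comp_sub_const s (2 * c)
  refine (((hasDerivAt_max_zero_sq s).sub h1).div_const (4 * c)).congr_deriv ?_
  unfold softStep
  rw [← mul_sub, show 4 * c = 2 * (2 * c) by ring, mul_div_mul_left _ _ two_ne_zero]

theorem continuous_softStep : Continuous (softStep c) := by
  unfold softStep
  fun_prop

theorem softStep_mono (hc : 0 < c) : Monotone (softStep c) := by
  intro s t hst
  unfold softStep
  gcongr ?_ / _
  rcases le_total s 0 with h1 | h1 <;> rcases le_total t 0 with h2 | h2 <;>
    rcases le_total (s - 2 * c) 0 with h3 | h3 <;> rcases le_total (t - 2 * c) 0 with h4 | h4 <;>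
    simp only [max_eq_left, max_eq_right, *] <;> linarith

theorem softStep_of_nonpos (hc : 0 < c) (hs : s ≤ 0) : softStep c s = 0 := by
  unfold softStep
  rw [max_eq_right hs, max_eq_right (by linarith), sub_self, zero_div]

theorem softStep_of_le (hc : 0 < c) (hs : 2 * c ≤ s) : softStep c s = 1 := by
  unfold softStep
  rw [max_eq_left (by linarith), max_eq_left (by linarith), sub_sub_cancel, div_self (by linarith)]

theorem softStep_nonneg (hc : 0 < c) : 0 ≤ softStep c s := by
  rw [← softStep_of_nonpos hc (min_le_right s 0)]
  exact softStep_mono hc (min_le_left _ _)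

theorem softStep_le_one (hc : 0 < c) : softStep c s ≤ 1 := by
  rw [← softStep_of_le hc (le_max_right s (2 * c))]
  exact softStep_mono hc (le_max_left _ _)

theorem softPos_of_nonpos (hc : 0 < c) (hs : s ≤ 0) : softPos c s = 0 := by
  unfold softPos
  rw [max_eq_right hs, max_eq_right (by linarith), sub_self, zero_div]

theorem softPos_of_le (hc : 0 < c) (hs : 2 * c ≤ s) : softPos c s = s - c := by
  unfold softPos
  rw [max_eq_left (by linarith), max_eq_left (by linarith)]
  field_simp
  ring

theorem softPos_nonneg (hc : 0 < c) : 0 ≤ softPos c s := by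
  unfold softPos
  have : max (s - 2 * c) 0 ≤ max s 0 := max_le_max_right _ (by linarith)
  have : max (s - 2 * c) 0 ^ 2 ≤ max s 0 ^ 2 := pow_le_pow_left₀ (le_max_right _ _) this 2
  exact div_nonneg (by linarith) (by linarith)

theorem softPos_pos (hc : 0 < c) (hs : 0 < s) : 0 < softPos c s := by
  unfold softPos
  have : max (s - 2 * c) 0 < max s 0 := by
    rw [max_eq_left hs.le]
    exact max_lt (by linarith) hs
  have : max (s - 2 * c) 0 ^ 2 < max s 0 ^ 2 :=
    pow_lt_pow_left₀ this (le_max_right _ _) two_ne_zero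
  exact div_pos (by linarith) (by linarith)

theorem sub_le_softPos (hc : 0 < c) : s - c ≤ softPos c s := by
  unfold softPos
  rw [le_div_iff₀ (by linarith)]
  rcases le_total s 0 with h1 | h1 <;> rcases le_total (s - 2 * c) 0 with h3 | h3 <;>
    simp only [max_eq_left, max_eq_right, *] <;> nlinarith [sq_nonneg (s - 2 * c)]

theorem softPos_le (hc : 0 < c) : softPos c s ≤ max s 0 := by
  unfold softPos
  rw [div_le_iff₀ (by linarith)]
  rcases le_total s 0 with h1 | h1 <;> rcases le_total (s - 2 * c) 0 with h3 | h3 <;>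
    simp only [max_eq_left, max_eq_right, *] <;> nlinarith [sq_nonneg (s - 2 * c)]

theorem mul_softStep_sub_softPos_le (hc : 0 < c) : s * softStep c s - softPos c s ≤ c := by
  rcases le_total s 0 with h1 | h1
  · rw [softStep_of_nonpos hc h1, softPos_of_nonpos hc h1]
    linarith
  rcases le_total (2 * c) s with h3 | h3
  · rw [softStep_of_le hc h3, softPos_of_le hc h3]
    linarith
  · unfold softStep softPos
    rw [max_eq_left h1, max_eq_right (by linarith)]
    have : s * ((s - 0) / (2 * c)) - (s ^ 2 - 0 ^ 2) / (4 * c) = s ^ 2 / (4 * c) := by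
      field_simp
      ring
    rw [this, div_le_iff₀ (by linarith)]
    nlinarith

end softPos

/-- A `C¹` monotone step function of height `m` and slope at most `κ`. -/
theorem exists_step {m κ S : ℝ} (hκ : 0 < κ) (hm : 0 < m) (hmS : m < κ * S) :
    ∃ (h h₁ : ℝ → ℝ) (ρ₀ ρ₂ : ℝ), 0 < ρ₀ ∧ 0 < ρ₂ ∧ ρ₂ < S ∧ (∀ s, HasDerivAt h (h₁ s) s) ∧
      Continuous h₁ ∧ (∀ s, 0 ≤ h₁ s) ∧ (∀ s, h₁ s ≤ κ) ∧ (∀ s, 0 ≤ h s) ∧ (∀ s, h s ≤ m) ∧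
      (∀ s ≤ ρ₀, h s = 0) ∧ ∀ s, ρ₂ ≤ s → h s = m := by
  have hL : m / κ < S := by rwa [div_lt_iff₀' hκ]
  have hL0 : 0 < m / κ := by positivity
  obtain ⟨ε, hε, hεS⟩ : ∃ ε > 0, m / κ + 4 * ε = S := ⟨(S - m / κ) / 4, by linarith, by ring⟩
  have hd (s : ℝ) : HasDerivAt
      (fun s ↦ κ * (softPos (ε / 2) (s - ε) - softPos (ε / 2) (s - (ε + m / κ))))
      (κ * (softStep (ε / 2) (s - ε) - softStep (ε / 2) (s - (ε + m / κ)))) s := by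
    have h1 (b : ℝ) : HasDerivAt (fun s ↦ softPos (ε / 2) (s - b)) (softStep (ε / 2) (s - b)) s := by
      exact hasDerivAt_softPos.comp_sub_const s b
    exact ((h1 _).sub (h1 _)).const_mul κ
  have hε2 : 0 < ε / 2 := by positivity
  have hnn (s : ℝ) : 0 ≤ κ * (softStep (ε / 2) (s - ε) - softStep (ε / 2) (s - (ε + m / κ))) :=
    mul_nonneg hκ.le (sub_nonneg.2 (softStep_mono hε2 (by linarith)))
  have hmono := monotone_of_hasDerivAt_nonneg hd hnn
  have h0 (s : ℝ) (hs : s ≤ ε) :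
      κ * (softPos (ε / 2) (s - ε) - softPos (ε / 2) (s - (ε + m / κ))) = 0 := by
    rw [softPos_of_nonpos hε2 (by linarith), softPos_of_nonpos hε2 (by linarith), sub_self, mul_zero]
  have h1 (s : ℝ) (hs : m / κ + 2 * ε ≤ s) :
      κ * (softPos (ε / 2) (s - ε) - softPos (ε / 2) (s - (ε + m / κ))) = m := by
    rw [softPos_of_le hε2 (by linarith), softPos_of_le hε2 (by linarith)]
    field_simp
    ring
  refine ⟨_, _, ε, m / κ + 2 * ε, hε, by positivity, by linarith, hd, ?_, hnn, fun s ↦ ?_,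
    fun s ↦ ?_, fun s ↦ ?_, h0, h1⟩
  · exact continuous_const.mul ((continuous_softStep.comp (by fun_prop)).sub
      (continuous_softStep.comp (by fun_prop)))
  · refine mul_le_of_le_one_right hκ.le ?_
    linarith [softStep_le_one hε2 (s := s - ε), softStep_nonneg hε2 (s := s - (ε + m / κ))]
  · rw [← h0 (min s ε) (min_le_right _ _)]
    exact hmono (min_le_left _ _)
  · refine le_of_le_of_eq ?_ (h1 (max s (m / κ + 2 * ε)) (le_max_right _ _))
    exact hmono (le_max_left _ _)

variable {X : Type*} [NormedAddCommGroup X] [InnerProductSpace ℝ X]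

theorem inner_self_map_eq_zero {J : X →L[ℝ] X} (hJ : ∀ x y, inner ℝ (J x) y = -inner ℝ x (J y))
    (x : X) : inner ℝ x (J x) = 0 := by
  have := hJ x x
  rw [real_inner_comm] at this
  linarith

/-- A rotation with angular speed less than `2 * π` has no nontrivial closed orbit of period `1`. -/
theorem smul_eq_zero_of_rotation {J : X →L[ℝ] X}
    (hJ : ∀ x y, inner ℝ (J x) y = -inner ℝ x (J y)) (hJ2 : ∀ x, J (J x) = -x) {p : ℝ → X} {l : ℝ}
    (hl : 0 ≤ l) (hlπ : l < 2 * Real.pi) (hp : ∀ t, HasDerivAt p (l • J (p t)) t) (h01 : p 1 = p 0) :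
    l • p 0 = 0 := by
  have hd (t : ℝ) : HasDerivAt (fun t ↦ Real.cos (l * t) • p t - Real.sin (l * t) • J (p t)) 0 t := by
    have h1 : HasDerivAt (fun t : ℝ ↦ l * t) l t := by simpa using (hasDerivAt_id t).const_mul l
    have h2 := (h1.cos.smul (hp t)).sub (h1.sin.smul (J.hasFDerivAt.comp_hasDerivAt t (hp t)))
    refine h2.congr_deriv ?_
    simp only [map_smul, hJ2, Function.comp_apply]
    module
  have hc := is_const_of_deriv_eq_zero (fun t ↦ (hd t).differentiableAt) (fun t ↦ (hd t).deriv) 1 0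
  simp only [mul_one, mul_zero, Real.cos_zero, Real.sin_zero, one_smul, zero_smul, sub_zero,
    h01] at hc
  have h3 : Real.cos l * ‖p 0‖ ^ 2 = ‖p 0‖ ^ 2 := by
    have := congrArg (inner ℝ (p 0)) hc
    rwa [inner_sub_right, inner_smul_right, inner_smul_right, inner_self_map_eq_zero hJ, mul_zero,
      sub_zero, real_inner_self_eq_norm_sq] at this
  rcases eq_or_ne (p 0) 0 with h0 | h0
  · rw [h0, smul_zero]
  · have h4 : Real.cos l = 1 := by
      have : ‖p 0‖ ^ 2 ≠ 0 := by positivity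
      exact mul_right_cancel₀ this (by linarith)
    rw [Real.cos_eq_one_iff_of_lt_of_lt (by linarith) hlπ] at h4
    rw [h4, zero_smul]

theorem contDiffAt_invFunOn {E F : Type*} [NormedAddCommGroup E] [NormedSpace ℝ E] [CompleteSpace E]
    [NormedAddCommGroup F] [NormedSpace ℝ F] {f : E → F} {a : E} {A : E ≃L[ℝ] F} {s : Set E}
    (hs : s ∈ 𝓝 a) (hf : ContDiffAt ℝ 1 f a) (hA : HasFDerivAt f (A : E →L[ℝ] F) a)
    (hinj : InjOn f s) :
    ContDiffAt ℝ 1 (Function.invFunOn f s) (f a) ∧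
      HasFDerivAt (Function.invFunOn f s) (A.symm : F →L[ℝ] E) (f a) ∧
      ∀ t ∈ 𝓝 a, f '' t ∈ 𝓝 (f a) := by
  have hS := hf.hasStrictFDerivAt' hA one_ne_zero
  have hT : Tendsto (hS.localInverse f A a) (𝓝 (f a)) (𝓝 a) := by
    simpa only [ContinuousAt, hS.localInverse_apply_image] using hS.localInverse_continuousAt
  have heq : Function.invFunOn f s =ᶠ[𝓝 (f a)] hS.localInverse f A a := by
    filter_upwards [hS.eventually_right_inverse, hT hs] with y hy hys
    have hex : ∃ x ∈ s, f x = y := ⟨_, hys, hy⟩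
    exact hinj (Function.invFunOn_mem hex) hys ((Function.invFunOn_eq hex).trans hy.symm)
  refine ⟨(hf.to_localInverse hA one_ne_zero).congr_of_eventuallyEq heq,
    hS.to_localInverse.hasFDerivAt.congr_of_eventuallyEq heq, fun t ht ↦ ?_⟩
  filter_upwards [hS.eventually_right_inverse, hT ht] with y hy hyt using ⟨_, hyt, hy⟩

theorem exists_equiv_of_inner_map_eq [FiniteDimensional ℝ X] {J A : X →L[ℝ] X}
    (hJ2 : ∀ x, J (J x) = -x) (hA : ∀ u v, inner ℝ (J (A u)) (A v) = inner ℝ (J u) v) :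
    ∃ A' : X ≃L[ℝ] X, (A' : X →L[ℝ] X) = A := by
  have hinj : Function.Injective (A : X →ₗ[ℝ] X) := by
    refine (injective_iff_map_eq_zero _).2 fun u hu ↦ ?_
    have hu' : A u = 0 := hu
    have h1 := hA u (J u)
    rw [hu', map_zero, inner_zero_left, eq_comm, inner_self_eq_zero] at h1
    have := hJ2 u
    rwa [h1, map_zero, eq_comm, neg_eq_zero] at this
  exact ⟨(LinearEquiv.ofInjectiveEndo _ hinj).toContinuousLinearEquiv, by ext; rfl⟩

/-- A Hamiltonian supported, up to an additive constant, in the image of a ball under a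
symplectic embedding and without fast nonconstant periodic orbits. -/
theorem exists_hamiltonian_of_symplectic [FiniteDimensional ℝ X] {J : X →L[ℝ] X}
    (hJ : ∀ x y, inner ℝ (J x) y = -inner ℝ x (J y)) (hJ2 : ∀ x, J (J x) = -x) {φ : X → X}
    {U : Set X} (hU : IsOpen U) {x₀ : X} {R : ℝ} (hR : 0 < R) (hBU : closedBall x₀ R ⊆ U)
    (hφ : ContDiffOn ℝ 1 φ U) (hinj : InjOn φ (closedBall x₀ R))
    (hsymp : ∀ x ∈ U, ∀ u v,
      inner ℝ (J (fderiv ℝ φ x u)) (fderiv ℝ φ x v) = inner ℝ (J u) v)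
    {m : ℝ} (hm : 0 < m) (hmR : m < Real.pi * R ^ 2) :
    ∃ G : X → ℝ, ContDiff ℝ 1 G ∧ (∀ z, 0 ≤ G z) ∧ (∀ z, G z ≤ m) ∧
      (∀ z ∉ φ '' closedBall x₀ R, G z = m) ∧ (∀ᶠ z in 𝓝 (φ x₀), G z = 0) ∧
      ∀ x : ℝ → X, (∀ t, HasDerivAt x (J (gradient G (x t))) t) → x 1 = x 0 →
        ∀ t, gradient G (x t) = 0 := by
  obtain ⟨κ, hκ0, hκπ, hκ⟩ : ∃ κ, 0 < κ ∧ κ < Real.pi ∧ m < κ * R ^ 2 := by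
    have hR2 : 0 < R ^ 2 := by positivity
    obtain ⟨κ, h1, h2⟩ := exists_between ((div_lt_iff₀ hR2).2 hmR)
    exact ⟨κ, lt_trans (by positivity) h1, h2, (div_lt_iff₀ hR2).1 h1⟩
  obtain ⟨h, h₁, ρ₀, ρ₂, hρ₀, hρ₂, hρR, hd, hc, hnn, hle, h0, hm', hzero, htop⟩ :=
    exists_step hκ0 hm hκ
  have hhC : ContDiff ℝ 1 h := by
    rw [contDiff_one_iff_deriv, funext fun s ↦ (hd s).deriv]
    exact ⟨fun s ↦ (hd s).differentiableAt, hc⟩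
  set ψ := Function.invFunOn φ (closedBall x₀ R) with hψ
  have hψφ {y : X} (hy : y ∈ closedBall x₀ R) : ψ (φ y) = y := hinj.leftInvOn_invFunOn hy
  classical
  set G : X → ℝ := fun z ↦ if z ∈ φ '' closedBall x₀ R then h (‖ψ z - x₀‖ ^ 2) else m with hG
  have hφC {y : X} (hy : y ∈ ball x₀ R) : ContDiffAt ℝ 1 φ y :=
    hφ.contDiffAt (hU.mem_nhds (hBU (ball_subset_closedBall hy)))
  have hloc {y : X} (hy : y ∈ ball x₀ R) : ContDiffAt ℝ 1 ψ (φ y) ∧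
      (∃ A : X →L[ℝ] X, HasFDerivAt ψ A (φ y) ∧ ∀ v, fderiv ℝ φ y (A v) = v) ∧
      ∀ t ∈ 𝓝 y, φ '' t ∈ 𝓝 (φ y) := by
    obtain ⟨A, hA⟩ := exists_equiv_of_inner_map_eq hJ2 (hsymp y (hBU (ball_subset_closedBall hy)))
    have hfd := ((hφC hy).differentiableAt one_ne_zero).hasFDerivAt
    rw [← hA] at hfd
    obtain ⟨h1, h2, h3⟩ := contDiffAt_invFunOn
      (mem_of_superset (isOpen_ball.mem_nhds hy) ball_subset_closedBall) (hφC hy) hfd hinj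
    exact ⟨h1, ⟨_, h2, fun v ↦ by simp [← hA]⟩, h3⟩
  have hGeq {y : X} (hy : y ∈ ball x₀ R) :
      G =ᶠ[𝓝 (φ y)] fun z ↦ h (‖ψ z - x₀‖ ^ 2) := by
    filter_upwards [(hloc hy).2.2 _ (mem_of_superset (isOpen_ball.mem_nhds hy)
      ball_subset_closedBall)] with z hz
    simp only [hG, if_pos hz]
  have hGm {z : X} (hz : G z ≠ m) : z ∈ φ '' closedBall x₀ √ρ₂ := by
    by_cases hzR : z ∈ φ '' closedBall x₀ R
    · simp only [hG, if_pos hzR] at hz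
      have h4 := Function.invFunOn_mem hzR
      refine ⟨ψ z, ?_, Function.invFunOn_eq hzR⟩
      rw [mem_closedBall, dist_eq_norm]
      refine Real.le_sqrt_of_sq_le (le_of_lt ?_)
      by_contra! hcon
      exact hz (htop _ hcon)
    · simp only [hG, if_neg hzR, ne_eq, not_true_eq_false] at hz
  have hsqrt : √ρ₂ < R := (Real.sqrt_lt' hR).2 hρR
  have hcl : IsClosed (φ '' closedBall x₀ √ρ₂) :=
    ((isCompact_closedBall _ _).image_of_continuousOn (hφ.continuousOn.mono
      ((closedBall_subset_closedBall hsqrt.le).trans hBU))).isClosed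
  have hGC : ContDiff ℝ 1 G := by
    rw [contDiff_iff_contDiffAt]
    intro z
    by_cases hz : z ∈ φ '' closedBall x₀ √ρ₂
    · obtain ⟨y, hy, rfl⟩ := hz
      have hy' : y ∈ ball x₀ R := closedBall_subset_ball hsqrt hy
      refine ContDiffAt.congr_of_eventuallyEq ?_ (hGeq hy')
      exact hhC.contDiffAt.comp _ (((hloc hy').1.sub contDiffAt_const).norm_sq ℝ)
    · refine (contDiffAt_const (c := m)).congr_of_eventuallyEq ?_
      filter_upwards [hcl.isOpen_compl.mem_nhds hz] with w hw
      by_contra hne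
      exact hw (hGm hne)
  have hGle (z : X) : G z ≤ m := by
    simp only [hG]
    split_ifs
    exacts [hm' _, le_rfl]
  have hGgrad (z : X) : HasGradientAt G (gradient G z) z :=
    (hGC.differentiable one_ne_zero z).hasGradientAt
  refine ⟨G, hGC, fun z ↦ ?_, hGle, fun z hz ↦ ?_, ?_, fun x hx h01 ↦ ?_⟩
  · simp only [hG]
    split_ifs
    exacts [h0 _, hm.le]
  · simp only [hG, if_neg hz]
  · have hx₀ : x₀ ∈ ball x₀ R := mem_ball_self hR
    have hcont : Tendsto (fun z ↦ ‖ψ z - x₀‖ ^ 2) (𝓝 (φ x₀)) (𝓝 0) := by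
      have := ((hloc hx₀).1.continuousAt.sub (continuousAt_const (y := x₀))).norm.pow 2
      simpa [ContinuousAt, hψφ (ball_subset_closedBall hx₀), Pi.pow_def] using this
    filter_upwards [hGeq hx₀, hcont.eventually_lt_const hρ₀] with z hz hz2
    rw [hz, hzero _ hz2.le]
  · have hconst (t : ℝ) : G (x t) = G (x 0) := by
      have hd' (t : ℝ) : HasDerivAt (fun t ↦ G (x t)) 0 t := by
        refine ((hGgrad (x t)).hasFDerivAt.comp_hasDerivAt t (hx t)).congr_deriv ?_
        simpa using inner_self_map_eq_zero hJ (gradient G (x t))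
      exact is_const_of_deriv_eq_zero (fun t ↦ (hd' t).differentiableAt)
        (fun t ↦ (hd' t).deriv) t 0
    by_cases hm0 : G (x 0) = m
    · intro t
      have hmax : IsLocalMax G (x t) := Eventually.of_forall fun z ↦ by
        rw [hconst, hm0]
        exact hGle z
      exact (map_eq_zero_iff _ (InnerProductSpace.toDual ℝ X).injective).1
        (hmax.hasFDerivAt_eq_zero (hGgrad (x t)).hasFDerivAt)
    have hball (t : ℝ) : ∃ y ∈ ball x₀ R, φ y = x t := by
      obtain ⟨y, hy, hyx⟩ := hGm (z := x t) (by rwa [hconst])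
      exact ⟨y, closedBall_subset_ball hsqrt hy, hyx⟩
    choose y hyR hyx using hball
    have hyψ (t : ℝ) : ψ (x t) = y t := by rw [← hyx, hψφ (ball_subset_closedBall (hyR t))]
    have hyd (t : ℝ) : ∃ w, HasDerivAt y w t ∧ fderiv ℝ φ (y t) w = J (gradient G (x t)) := by
      obtain ⟨A, hA, hA2⟩ := (hloc (hyR t)).2.1
      refine ⟨A (J (gradient G (x t))), ?_, hA2 _⟩
      rw [hyx] at hA
      simpa only [Function.comp_def, hyψ] using hA.comp_hasDerivAt t (hx t)
    choose w hw hwφ using hyd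
    have hgradφ (t : ℝ) (v : X) : inner ℝ (gradient G (x t)) (fderiv ℝ φ (y t) v)
        = 2 * h₁ (‖y t - x₀‖ ^ 2) * inner ℝ (y t - x₀) v := by
      have h5 : HasFDerivAt (fun u ↦ G (φ u)) _ (y t) :=
        HasFDerivAt.comp (g := G) (y t) (by rw [hyx]; exact (hGgrad (x t)).hasFDerivAt)
          ((hφC (hyR t)).differentiableAt one_ne_zero).hasFDerivAt
      have h6 : HasFDerivAt (fun u ↦ h (‖u - x₀‖ ^ 2)) _ (y t) :=
        (hd _).comp_hasFDerivAt (y t) ((hasFDerivAt_id (y t)).sub_const x₀).norm_sq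
      have h7 : (fun u ↦ G (φ u)) =ᶠ[𝓝 (y t)] fun u ↦ h (‖u - x₀‖ ^ 2) := by
        filter_upwards [isOpen_ball.mem_nhds (hyR t)] with u hu
        have hu' := ball_subset_closedBall hu
        simp only [hG, if_pos (mem_image_of_mem φ hu'), hψφ hu']
      have h8 := congrArg (fun L : X →L[ℝ] ℝ ↦ L v) (h5.unique (h6.congr_of_eventuallyEq h7))
      simp only [toDual_gradient, ContinuousLinearMap.comp_apply, smul_apply, smul_eq_mul,
        innerSL_apply_apply, ContinuousLinearMap.id_apply, nsmul_eq_mul, Nat.cast_ofNat,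
        id_eq] at h8
      rw [inner_gradient_left, h8]
      ring
    have hwJ (t : ℝ) : w t = (2 * h₁ (‖y t - x₀‖ ^ 2)) • J (y t - x₀) := by
      have h9 : J (w t) = -((2 * h₁ (‖y t - x₀‖ ^ 2)) • (y t - x₀)) := by
        refine ext_inner_right ℝ fun v ↦ ?_
        rw [← hsymp (y t) (hBU (ball_subset_closedBall (hyR t))), hwφ, hJ2, inner_neg_left,
          hgradφ, inner_neg_left, real_inner_smul_left]
      have h10 := congrArg J h9
      rw [hJ2, map_neg, neg_inj, map_smul] at h10
      exact h10
    have hnorm (t : ℝ) : ‖y t - x₀‖ ^ 2 = ‖y 0 - x₀‖ ^ 2 := by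
      have hd' (t : ℝ) : HasDerivAt (fun t ↦ ‖y t - x₀‖ ^ 2) 0 t := by
        refine (((hw t).sub_const x₀).norm_sq).congr_deriv ?_
        rw [hwJ, real_inner_smul_right, inner_self_map_eq_zero hJ, mul_zero, mul_zero]
      exact is_const_of_deriv_eq_zero (fun t ↦ (hd' t).differentiableAt)
        (fun t ↦ (hd' t).deriv) t 0
    have hrot : (2 * h₁ (‖y 0 - x₀‖ ^ 2)) • (y 0 - x₀) = 0 := by
      refine smul_eq_zero_of_rotation hJ hJ2 (p := fun t ↦ y t - x₀)
        (by linarith [hnn (‖y 0 - x₀‖ ^ 2)]) (by linarith [hle (‖y 0 - x₀‖ ^ 2)]) (fun t ↦ ?_) ?_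
      · have := (hw t).sub_const x₀
        rwa [hwJ, hnorm] at this
      · simp only [← hyψ, h01]
    intro t
    have hw0 : w t = 0 := by
      rw [hwJ, hnorm, ← norm_eq_zero, norm_smul]
      rcases smul_eq_zero.1 hrot with h11 | h11
      · rw [h11, norm_zero, zero_mul]
      · have : ‖y t - x₀‖ ^ 2 = 0 := by rw [hnorm, h11, norm_zero, zero_pow two_ne_zero]
        rw [norm_eq_zero.1 (pow_eq_zero_iff two_ne_zero |>.1 this), map_zero, norm_zero, mul_zero]
    have h12 := hwφ t
    rw [hw0, map_zero] at h12
    have h13 := hJ2 (gradient G (x t))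
    rwa [← h12, map_zero, eq_comm, neg_eq_zero] at h13

theorem hasFDerivAt_inner_map_sub {B : X →L[ℝ] X}
    (hBs : ∀ x y, inner ℝ (B x) y = inner ℝ x (B y)) (c z : X) :
    HasFDerivAt (fun z ↦ inner ℝ (B (z - c)) (z - c)) (innerSL ℝ ((2 : ℝ) • B (z - c))) z := by
  have h1 : HasFDerivAt (fun z ↦ z - c) (ContinuousLinearMap.id ℝ X) z :=
    (hasFDerivAt_id z).sub_const c
  refine ((B.hasFDerivAt.comp z h1).inner ℝ h1).congr_fderiv ?_
  ext v
  have : inner ℝ (B v) (z - c) = inner ℝ (B (z - c)) v := by rw [hBs, real_inner_comm]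
  simp [this, two_mul, inner_sub_left]

/-- The image of a ball of radius `R` under a symplectic embedding is not contained in the
ellipsoid `{z | ⟪B (z - c), z - c⟫ < σ}` when `σ < π * R ^ 2`, the operator `B` is nonresonant and
one of its eigenvalues exceeds `π`. -/
theorem false_of_symplectic_embedding [FiniteDimensional ℝ X] {J : X →L[ℝ] X}
    (hJ : ∀ x y, inner ℝ (J x) y = -inner ℝ x (J y)) (hJ2 : ∀ x, J (J x) = -x) {B : X →L[ℝ] X}
    (hBJ : ∀ x, B (J x) = J (B x)) (hBs : ∀ x y, inner ℝ (B x) y = inner ℝ x (B y))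
    {e : X} (he : ‖e‖ = 1) {a : ℝ} (hBe : B e = a • e)
    (ha : Real.pi < a) {δ₀ : ℝ} (hδ₀ : 0 < δ₀) (hBδ : ∀ x, δ₀ * ‖x‖ ^ 2 ≤ inner ℝ (B x) x)
    {ν : ℝ} (hν : 0 < ν)
    (hBν : ∀ (j : ℤ) x, ν * (1 + |(j : ℝ)|) * ‖x‖ ≤ ‖(Real.pi * j) • x - B x‖)
    {φ : X → X} {U : Set X} (hU : IsOpen U) {x₀ : X} {R : ℝ} (hR : 0 < R)
    (hBU : closedBall x₀ R ⊆ U) (hφ : ContDiffOn ℝ 1 φ U) (hinj : InjOn φ (closedBall x₀ R))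
    (hsymp : ∀ x ∈ U, ∀ u v,
      inner ℝ (J (fderiv ℝ φ x u)) (fderiv ℝ φ x v) = inner ℝ (J u) v)
    (hφ0 : φ x₀ = 0) {c : X} {σ : ℝ} (hσ : σ < Real.pi * R ^ 2)
    (hsub : ∀ x ∈ closedBall x₀ R, inner ℝ (B (φ x - c)) (φ x - c) < σ) : False := by
  obtain ⟨m, hσm, hmR⟩ := exists_between hσ
  set q : X → ℝ := fun z ↦ inner ℝ (B (z - c)) (z - c) with hq
  have hqc : Continuous q := by
    simp only [hq]
    fun_prop
  have hq0 (z : X) : 0 ≤ q z := le_trans (by positivity) (hBδ (z - c))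
  have hσ0 : 0 < σ := (hq0 _).trans_lt (hsub x₀ (mem_closedBall_self hR.le))
  have hm : 0 < m := hσ0.trans hσm
  have hd : 0 < m - σ := sub_pos.2 hσm
  obtain ⟨G, hGC, hG0, hGm, hGeq, hGz, hGorb⟩ :=
    exists_hamiltonian_of_symplectic hJ hJ2 hU hR hBU hφ hinj hsymp hm hmR
  have hGgrad (z : X) : HasGradientAt G (gradient G z) z :=
    (hGC.differentiable one_ne_zero z).hasGradientAt
  have hGgc : Continuous (gradient G) :=
    (InnerProductSpace.toDual ℝ X).symm.continuous.comp (hGC.continuous_fderiv one_ne_zero)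
  have hGmax {z : X} (hz : G z = m) : gradient G z = 0 := by
    have hmax : IsLocalMax G z := Eventually.of_forall fun w ↦ by
      rw [hz]
      exact hGm w
    exact (map_eq_zero_iff _ (InnerProductSpace.toDual ℝ X).injective).1
      (hmax.hasFDerivAt_eq_zero (hGgrad z).hasFDerivAt)
  have hGout {z : X} (hz : σ < q z) : G z = m := by
    refine hGeq z ?_
    rintro ⟨y, hy, rfl⟩
    exact lt_asymm hz (hsub y hy)
  set T : X → ℝ := fun z ↦ softPos (m - σ) (q z - σ) with hT
  set S : X → ℝ := fun z ↦ softStep (m - σ) (q z - σ) with hS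
  have hTd (z : X) : HasFDerivAt T (innerSL ℝ ((2 * S z) • B (z - c))) z := by
    refine (hasDerivAt_softPos.comp_hasFDerivAt z
      ((hasFDerivAt_inner_map_sub hBs c z).sub_const σ)).congr_fderiv ?_
    ext v
    simp only [hS, hq, smul_apply, innerSL_apply_apply, inner_smul_left, smul_eq_mul, conj_trivial]
    ring
  have hSc : Continuous S := continuous_softStep.comp (hqc.sub continuous_const)
  set H : X → ℝ := fun z ↦ G z + T z with hH
  set g : X → X := fun z ↦ gradient G z + (2 * S z) • B (z - c) with hgdef
  have hg (z : X) : HasGradientAt H (g z) z := by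
    rw [hasGradientAt_iff_hasFDerivAt]
    refine ((hGgrad z).hasFDerivAt.add (hTd z)).congr_fderiv ?_
    rw [map_add]
    rfl
  have hgc : Continuous g := by
    simp only [hgdef]
    fun_prop
  have hGnn (z : X) : 0 ≤ H z := add_nonneg (hG0 z) (softPos_nonneg hd)
  obtain ⟨C₁, hC₁⟩ : ∃ C₁, ∀ z, ‖g z - (2 : ℝ) • B z‖ ≤ C₁ := by
    obtain ⟨M, hM⟩ := (isCompact_closedBall c √((2 * (m - σ) + σ) / δ₀)).exists_bound_of_continuousOn
      (f := fun z ↦ g z - (2 : ℝ) • B z) (by fun_prop)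
    refine ⟨max M ‖(2 : ℝ) • B c‖, fun z ↦ ?_⟩
    by_cases hz : z ∈ closedBall c √((2 * (m - σ) + σ) / δ₀)
    · exact (hM z hz).trans (le_max_left _ _)
    · refine le_trans (le_of_eq ?_) (le_max_right _ _)
      rw [mem_closedBall, dist_eq_norm, not_le] at hz
      replace hz := Real.lt_sq_of_sqrt_lt hz
      rw [div_lt_iff₀' hδ₀] at hz
      have hqz : 2 * (m - σ) + σ < q z := hz.trans_le (hBδ _)
      have h1 : S z = 1 := softStep_of_le hd (by linarith)
      simp only [hgdef, hGmax (hGout (by linarith : σ < q z)), h1, map_sub]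
      rw [← norm_neg]
      congr 1
      module
  have hq00 : q 0 < σ := by
    have := hsub x₀ (mem_closedBall_self hR.le)
    rwa [hφ0] at this
  obtain ⟨ρ, hρ0, hρ⟩ : ∃ ρ > 0, ∀ z, ‖z‖ < ρ → H z = 0 := by
    rw [hφ0] at hGz
    have h1 : ∀ᶠ z in 𝓝 (0 : X), H z = 0 := by
      filter_upwards [hGz, hqc.continuousAt.eventually_lt_const hq00] with z hz hz2
      simp only [hH, hT, hz, softPos_of_nonpos hd (sub_nonpos.2 hz2.le), add_zero]
    obtain ⟨ρ, hρ, h2⟩ := Metric.eventually_nhds_iff.1 h1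
    exact ⟨ρ, hρ, fun z hz ↦ h2 (by simpa using hz)⟩
  have hHl (z : X) : inner ℝ (B (z - c)) (z - c) - m ≤ H z := by
    have h1 : q z - σ - (m - σ) ≤ T z := sub_le_softPos hd
    have h2 := hG0 z
    simp only [hH, hq] at h1 ⊢
    linarith
  have hHu (z : X) : H z ≤ (m / ρ ^ 2 + ‖B‖ * (1 + ‖c‖ / ρ) ^ 2) * ‖z‖ ^ 2 := by
    rcases lt_or_ge ‖z‖ ρ with hz | hz
    · rw [hρ z hz]
      positivity
    · have h1 : G z ≤ m / ρ ^ 2 * ‖z‖ ^ 2 := by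
        rw [div_mul_eq_mul_div, le_div_iff₀ (by positivity)]
        have : ρ ^ 2 ≤ ‖z‖ ^ 2 := pow_le_pow_left₀ hρ0.le hz 2
        exact mul_le_mul (hGm z) this (by positivity) hm.le
      have h2 : T z ≤ q z := (softPos_le hd).trans (max_le (by linarith) (hq0 z))
      have h3 : ‖z - c‖ ≤ (1 + ‖c‖ / ρ) * ‖z‖ := by
        have : ‖c‖ ≤ ‖c‖ / ρ * ‖z‖ := by
          rw [div_mul_eq_mul_div, le_div_iff₀ hρ0]
          gcongr
        linarith [norm_sub_le z c]
      have h4 : q z ≤ ‖B‖ * ‖z - c‖ ^ 2 := by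
        refine (real_inner_le_norm _ _).trans ?_
        rw [pow_two, ← mul_assoc]
        gcongr
        exact B.le_opNorm _
      have h5 : ‖B‖ * ‖z - c‖ ^ 2 ≤ ‖B‖ * ((1 + ‖c‖ / ρ) * ‖z‖) ^ 2 := by gcongr
      simp only [hH]
      rw [mul_pow] at h5
      linarith
  obtain ⟨x, hx, hx0, hpos⟩ := exists_periodic_orbit hJ hJ2 hBJ he hBe ha hδ₀ hBδ hν hBν hg hgc hC₁
    hGnn hρ0 hρ hm.le hHl (by positivity) hHu
  have hTconst (t : ℝ) : T (x t) = T (x (0 : ℝ)) := by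
    have hd' (t : ℝ) : HasDerivAt (fun t : ℝ ↦ T (x t)) 0 t := by
      refine ((hTd (x t)).comp_hasDerivAt t (hx t)).congr_deriv ?_
      rcases le_or_gt (q (x t)) σ with h1 | h1
      · have : S (x t) = 0 := softStep_of_nonpos hd (sub_nonpos.2 h1)
        simp [this]
      · simp only [hgdef, hGmax (hGout h1), zero_add, innerSL_apply_apply]
        exact inner_self_map_eq_zero hJ _
    exact is_const_of_deriv_eq_zero (fun t ↦ (hd' t).differentiableAt)
      (fun t ↦ (hd' t).deriv) t 0
  have hact (t : ℝ) : 1 / 2 * inner ℝ (g (x t)) (x t - c) - H (x t) ≤ 0 := by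
    have hint (hgr : gradient G (x t) = 0) : 1 / 2 * inner ℝ (g (x t)) (x t - c) - H (x t)
        = S (x t) * q (x t) - G (x t) - T (x t) := by
      simp only [hgdef, hgr, zero_add, hH, hq, real_inner_smul_left]
      ring
    by_cases hT0 : T (x (0 : ℝ)) = 0
    · have hqle (t : ℝ) : q (x t) ≤ σ := by
        by_contra! hcon
        exact (softPos_pos hd (sub_pos.2 hcon)).ne' ((hTconst t).trans hT0)
      have hS0 (t : ℝ) : S (x t) = 0 := softStep_of_nonpos hd (sub_nonpos.2 (hqle t))
      have hgr : gradient G (x t) = 0 := by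
        refine hGorb (fun t ↦ x t) (fun t ↦ ?_) ?_ t
        · have := hx t
          simpa only [hgdef, hS0, mul_zero, zero_smul, add_zero] using this
        · simp only [AddCircle.coe_period, QuotientAddGroup.mk_zero]
      rw [hint hgr, hS0, hTconst, hT0]
      linarith [hG0 (x t)]
    · have hqt : σ < q (x t) := by
        by_contra! hcon
        refine hT0 ?_
        rw [← hTconst t]
        exact softPos_of_nonpos hd (sub_nonpos.2 hcon)
      rw [hint (hGmax (hGout hqt)), hGout hqt]
      have h1 : (q (x t) - σ) * S (x t) - T (x t) ≤ m - σ := mul_softStep_sub_softPos_le hd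
      have h2 : σ * S (x t) ≤ σ := mul_le_of_le_one_right hσ0.le (softStep_le_one hd)
      linarith
  refine hpos.not_ge ?_
  have hi1 : Continuous fun t : UnitAddCircle ↦ 1 / 2 * inner ℝ (g (x t)) (x t - c) - H (x t) := by
    have hHc : Continuous H := continuous_iff_continuousAt.2 fun z ↦ (hg z).continuousAt
    fun_prop
  have hi2 : Continuous fun t : UnitAddCircle ↦ 1 / 2 * inner ℝ (g (x t)) c := by fun_prop
  calc ∫ t, (1 / 2 * inner ℝ (g (x t)) (x t) - H (x t)) ∂haarAddCircle
      = ∫ t, ((1 / 2 * inner ℝ (g (x t)) (x t - c) - H (x t)) + 1 / 2 * inner ℝ (g (x t)) c)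
          ∂haarAddCircle := by
        congr 1 with t
        rw [inner_sub_right]
        ring
    _ = ∫ t, (1 / 2 * inner ℝ (g (x t)) (x t - c) - H (x t)) ∂haarAddCircle := by
        rw [integral_add hi1.integrable_haar hi2.integrable_haar, integral_const_mul, hx0, mul_zero,
          add_zero]
    _ ≤ 0 := by
        refine integral_nonpos fun t ↦ ?_
        obtain ⟨s, rfl⟩ := QuotientAddGroup.mk_surjective t
        exact hact s

end

section

open Set Metric Module Filter Topology

theorem exists_abs_pi_mul_sub_ge {θ : ℝ} (h0 : 0 < θ) (h1 : θ ≠ Real.pi) (h2 : θ < 2 * Real.pi) :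
    ∃ ν > 0, ∀ j : ℤ, ν * (1 + |(j : ℝ)|) ≤ |Real.pi * j - θ| := by
  have hπ := Real.pi_pos
  have h1' : 0 < |Real.pi - θ| := abs_pos.2 (sub_ne_zero.2 h1.symm)
  obtain ⟨ν, hν, hν1, hν2, hν3⟩ :
      ∃ ν > 0, ν ≤ θ ∧ 2 * ν ≤ |Real.pi - θ| ∧ 3 * ν ≤ 2 * Real.pi - θ := by
    refine ⟨min θ (min (|Real.pi - θ| / 2) ((2 * Real.pi - θ) / 3)),
      lt_min h0 (lt_min (by linarith) (by linarith)), min_le_left _ _, ?_, ?_⟩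
    · linarith [(min_le_right θ _).trans (min_le_left (|Real.pi - θ| / 2) ((2 * Real.pi - θ) / 3))]
    · linarith [(min_le_right θ _).trans (min_le_right (|Real.pi - θ| / 2) ((2 * Real.pi - θ) / 3))]
  refine ⟨ν, hν, fun j ↦ ?_⟩
  rcases lt_trichotomy j 1 with hj | rfl | hj
  · have hj0 : (j : ℝ) ≤ 0 := by exact_mod_cast Int.lt_add_one_iff.1 hj
    rw [abs_of_nonpos hj0, abs_of_nonpos (by nlinarith)]
    nlinarith
  · simpa [mul_comm, one_add_one_eq_two] using hν2
  · have hj0 : (2 : ℝ) ≤ j := by exact_mod_cast hj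
    rw [abs_of_nonneg (by linarith), abs_of_nonneg (by nlinarith)]
    nlinarith

variable {N : ℕ}

/-- The complex structure `(p, q) ↦ (-q, p)`. -/
noncomputable def complexStructure (N : ℕ) :
    EuclideanSpace ℝ (Fin N ⊕ Fin N) →L[ℝ] EuclideanSpace ℝ (Fin N ⊕ Fin N) :=
  LinearMap.toContinuousLinearMap
    { toFun := fun u ↦ WithLp.toLp 2 (Sum.elim (fun i ↦ -u (Sum.inr i)) fun i ↦ u (Sum.inl i))
      map_add' := fun u v ↦ by
        ext (i | i) <;> simp [add_comm]
      map_smul' := fun s u ↦ by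
        ext (i | i) <;> simp }

@[simp] theorem complexStructure_inl (u : EuclideanSpace ℝ (Fin N ⊕ Fin N)) (i : Fin N) :
    complexStructure N u (Sum.inl i) = -u (Sum.inr i) := rfl

@[simp] theorem complexStructure_inr (u : EuclideanSpace ℝ (Fin N ⊕ Fin N)) (i : Fin N) :
    complexStructure N u (Sum.inr i) = u (Sum.inl i) := rfl

theorem inner_eq_sum (u v : EuclideanSpace ℝ (Fin N ⊕ Fin N)) :
    inner ℝ u v = ∑ i, (u (Sum.inl i) * v (Sum.inl i) + u (Sum.inr i) * v (Sum.inr i)) := by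
  simp [PiLp.inner_apply, Finset.sum_add_distrib, mul_comm]

theorem norm_sq_eq_sum (u : EuclideanSpace ℝ (Fin N ⊕ Fin N)) :
    ‖u‖ ^ 2 = ∑ i, (u (Sum.inl i) ^ 2 + u (Sum.inr i) ^ 2) := by
  rw [← real_inner_self_eq_norm_sq, inner_eq_sum]
  simp only [pow_two]

theorem omega0_eq_inner (u v : EuclideanSpace ℝ (Fin N ⊕ Fin N)) :
    omega0 N u v = inner ℝ (complexStructure N u) v := by
  rw [omega0, inner_eq_sum]
  refine Finset.sum_congr rfl fun i _ ↦ ?_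
  simp only [complexStructure_inl, complexStructure_inr]
  ring

/-- The operator multiplying the `i`-th coordinate plane by `W i`. -/
noncomputable def planeScaling (W : Fin N → ℝ) :
    EuclideanSpace ℝ (Fin N ⊕ Fin N) →L[ℝ] EuclideanSpace ℝ (Fin N ⊕ Fin N) :=
  LinearMap.toContinuousLinearMap
    { toFun := fun u ↦ WithLp.toLp 2 fun k ↦ Sum.elim W W k * u k
      map_add' := fun u v ↦ by
        ext k
        simp [mul_add]
      map_smul' := fun s u ↦ by
        ext k
        simp [mul_left_comm] }

theorem planeScaling_apply (W : Fin N → ℝ) (u : EuclideanSpace ℝ (Fin N ⊕ Fin N))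
    (k : Fin N ⊕ Fin N) : planeScaling W u k = Sum.elim W W k * u k := rfl

@[simp] theorem planeScaling_inl (W : Fin N → ℝ) (u : EuclideanSpace ℝ (Fin N ⊕ Fin N))
    (i : Fin N) : planeScaling W u (Sum.inl i) = W i * u (Sum.inl i) := rfl

@[simp] theorem planeScaling_inr (W : Fin N → ℝ) (u : EuclideanSpace ℝ (Fin N ⊕ Fin N))
    (i : Fin N) : planeScaling W u (Sum.inr i) = W i * u (Sum.inr i) := rfl

theorem inner_planeScaling_self (W : Fin N → ℝ) (u : EuclideanSpace ℝ (Fin N ⊕ Fin N)) :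
    inner ℝ (planeScaling W u) u = ∑ i, W i * (u (Sum.inl i) ^ 2 + u (Sum.inr i) ^ 2) := by
  rw [inner_eq_sum]
  refine Finset.sum_congr rfl fun i _ ↦ ?_
  simp only [planeScaling_inl, planeScaling_inr]
  ring

theorem mul_norm_le_norm_smul_sub_planeScaling {W : Fin N → ℝ} {ν s : ℝ} (hν : 0 ≤ ν)
    (hW : ∀ i, ν ≤ |s - W i|) (u : EuclideanSpace ℝ (Fin N ⊕ Fin N)) :
    ν * ‖u‖ ≤ ‖s • u - planeScaling W u‖ := by
  refine le_of_sq_le_sq ?_ (norm_nonneg _)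
  rw [mul_pow, norm_sq_eq_sum, norm_sq_eq_sum, Finset.mul_sum]
  refine Finset.sum_le_sum fun i _ ↦ ?_
  have h1 : ν ^ 2 ≤ (s - W i) ^ 2 := by
    rw [← sq_abs (s - W i)]
    exact pow_le_pow_left₀ hν (hW i) 2
  simp only [PiLp.sub_apply, PiLp.smul_apply, planeScaling_inl, planeScaling_inr, smul_eq_mul,
    ← sub_mul, mul_pow, ← mul_add]
  gcongr

end

/-- **Gromov's non-squeezing theorem.**  Let `N ≥ 1`, `R, r > 0`, `z = (z₁, z₂) ∈ ℝ²`,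
`k₀` a coordinate index, and `x* ∈ ℝ^{2N}`.  Let `φ` be a symplectomorphism defined on
`B_R(x*)`, i.e. `φ` is continuously differentiable on an open neighborhood `U` of the closed
ball `B_R(x*)`, injective on `B_R(x*)`, and its derivative preserves the standard symplectic
form `ω₀` at every point of `U`.  If `r < R`, then `φ(B_R(x*))` is not contained in the
cylinder `C_r(z; k₀)`. -/
theorem gromov_nonsqueezing (N : ℕ) (hN : 1 ≤ N) (R r : ℝ) (hR : 0 < R) (hr : 0 < r)
    (z₁ z₂ : ℝ) (k₀ : Fin N) (xstar : EuclideanSpace ℝ (Fin N ⊕ Fin N))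
    (φ : EuclideanSpace ℝ (Fin N ⊕ Fin N) → EuclideanSpace ℝ (Fin N ⊕ Fin N))
    (U : Set (EuclideanSpace ℝ (Fin N ⊕ Fin N)))
    (hUopen : IsOpen U) (hBU : Metric.closedBall xstar R ⊆ U)
    (hC1 : ContDiffOn ℝ 1 φ U)
    (hinj : Set.InjOn φ (Metric.closedBall xstar R))
    (hsymp : ∀ x ∈ U, ∀ u v : EuclideanSpace ℝ (Fin N ⊕ Fin N),
      omega0 N (fderiv ℝ φ x u) (fderiv ℝ φ x v) = omega0 N u v)
    (hrR : r < R) :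
    ¬ (φ '' Metric.closedBall xstar R ⊆ cylinder N r z₁ z₂ k₀) := by
  intro hsub
  have hr2 : r ^ 2 < R ^ 2 := pow_lt_pow_left₀ hrR hr.le two_ne_zero
  have hπ := Real.pi_pos
  obtain ⟨a, haπ, ha⟩ : ∃ a, Real.pi < a ∧ a < min (2 * Real.pi) (Real.pi * R ^ 2 / r ^ 2) := by
    refine exists_between (lt_min (by linarith) ?_)
    rw [lt_div_iff₀ (by positivity)]
    gcongr
  obtain ⟨ha2, har⟩ := lt_min_iff.1 ha
  rw [lt_div_iff₀ (by positivity)] at har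
  set Z : EuclideanSpace ℝ (Fin N ⊕ Fin N) :=
    EuclideanSpace.single (Sum.inl k₀) z₁ + EuclideanSpace.single (Sum.inr k₀) z₂ with hZ
  obtain ⟨M, hM⟩ := (isCompact_closedBall xstar R).exists_bound_of_continuousOn
    (f := fun x ↦ φ x - Z) ((hC1.continuousOn.mono hBU).sub continuousOn_const)
  obtain ⟨δ, hδ0, hδπ, hδM⟩ : ∃ δ > 0, δ < Real.pi ∧ a * r ^ 2 + δ * M ^ 2 < Real.pi * R ^ 2 := by
    have h1 : 0 < (Real.pi * R ^ 2 - a * r ^ 2) / (M ^ 2 + 1) :=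
      div_pos (sub_pos.2 har) (by positivity)
    obtain ⟨δ, hδ0, hδ⟩ := exists_between (lt_min hπ h1)
    obtain ⟨hδ1, hδ2⟩ := lt_min_iff.1 hδ
    rw [lt_div_iff₀ (by positivity)] at hδ2
    exact ⟨δ, hδ0, hδ1, by linarith⟩
  obtain ⟨σ, hσ1, hσ2⟩ := exists_between hδM
  set W : Fin N → ℝ := fun i ↦ if i = k₀ then a else δ with hW
  obtain ⟨ν, hν, hνW⟩ : ∃ ν > 0, ∀ (j : ℤ) i, ν * (1 + |(j : ℝ)|) ≤ |Real.pi * j - W i| := by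
    obtain ⟨ν₁, hν₁, h1⟩ := exists_abs_pi_mul_sub_ge (hπ.trans haπ) haπ.ne' ha2
    obtain ⟨ν₂, hν₂, h2⟩ := exists_abs_pi_mul_sub_ge hδ0 hδπ.ne (by linarith)
    refine ⟨min ν₁ ν₂, lt_min hν₁ hν₂, fun j i ↦ ?_⟩
    simp only [hW]
    split_ifs
    · exact (mul_le_mul_of_nonneg_right (min_le_left _ _) (by positivity)).trans (h1 j)
    · exact (mul_le_mul_of_nonneg_right (min_le_right _ _) (by positivity)).trans (h2 j)
  have hWδ (i : Fin N) : δ ≤ W i := by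
    simp only [hW]
    split_ifs <;> linarith
  refine false_of_symplectic_embedding (J := complexStructure N) (B := planeScaling W)
    (e := EuclideanSpace.single (Sum.inl k₀) 1) (φ := fun x ↦ φ x - φ xstar) (c := Z - φ xstar)
    (fun x y ↦ ?_) (fun x ↦ ?_) (fun x ↦ ?_) (fun x y ↦ ?_) (by simp) (a := a) ?_ haπ hδ0
    (fun x ↦ ?_) hν (fun j x ↦ ?_) hUopen hR hBU (hC1.sub contDiffOn_const) (fun x hx y hy hxy ↦ ?_)
    (fun x hx u v ↦ ?_) (sub_self _) hσ2 fun x hx ↦ ?_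
  · rw [inner_eq_sum, inner_eq_sum, ← Finset.sum_neg_distrib]
    refine Finset.sum_congr rfl fun i _ ↦ ?_
    simp only [complexStructure_inl, complexStructure_inr]
    ring
  · ext (i | i) <;> simp
  · ext (i | i) <;> simp
  · rw [inner_eq_sum, inner_eq_sum]
    refine Finset.sum_congr rfl fun i _ ↦ ?_
    simp only [planeScaling_inl, planeScaling_inr]
    ring
  · ext k
    rcases eq_or_ne k (Sum.inl k₀) with rfl | hk
    · simp [hW]
    · simp [planeScaling_apply, hk]
  · rw [inner_planeScaling_self, norm_sq_eq_sum, Finset.mul_sum]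
    gcongr
    exact hWδ _
  · exact mul_norm_le_norm_smul_sub_planeScaling (by positivity) (hνW j) x
  · exact hinj hx hy (sub_left_injective hxy)
  · simp only [fderiv_sub_const, ← omega0_eq_inner]
    exact hsymp x hx u v
  · rw [sub_sub_sub_cancel_right, inner_planeScaling_self]
    refine lt_of_le_of_lt ?_ hσ1
    have h1 : (φ x (Sum.inl k₀) - z₁) ^ 2 + (φ x (Sum.inr k₀) - z₂) ^ 2 ≤ r ^ 2 :=
      hsub ⟨x, hx, rfl⟩
    have h2 : ‖φ x - Z‖ ^ 2 ≤ M ^ 2 := pow_le_pow_left₀ (norm_nonneg _) (hM x hx) 2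
    rw [norm_sq_eq_sum] at h2
    set y := φ x - Z with hy
    have h3 : y (Sum.inl k₀) ^ 2 + y (Sum.inr k₀) ^ 2 ≤ r ^ 2 := by simpa [hy, hZ] using h1
    calc ∑ i, W i * (y (Sum.inl i) ^ 2 + y (Sum.inr i) ^ 2)
        ≤ ∑ i, ((if i = k₀ then a * (y (Sum.inl k₀) ^ 2 + y (Sum.inr k₀) ^ 2) else 0)
            + δ * (y (Sum.inl i) ^ 2 + y (Sum.inr i) ^ 2)) := by
          refine Finset.sum_le_sum fun i _ ↦ ?_
          simp only [hW]
          split_ifs with hi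
          · rw [hi]
            linarith [mul_nonneg hδ0.le
              (add_nonneg (sq_nonneg (y (Sum.inl k₀))) (sq_nonneg (y (Sum.inr k₀))))]
          · rw [zero_add]
      _ = a * (y (Sum.inl k₀) ^ 2 + y (Sum.inr k₀) ^ 2)
            + δ * ∑ i, (y (Sum.inl i) ^ 2 + y (Sum.inr i) ^ 2) := by
          rw [Finset.sum_add_distrib, ← Finset.mul_sum, Finset.sum_ite_eq' Finset.univ k₀ fun _ ↦ _,
            if_pos (Finset.mem_univ _)]
      _ ≤ a * r ^ 2 + δ * M ^ 2 := by
          have : 0 ≤ a := by linarith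
          gcongr
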